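/- arXiv:2212.07122 — 4 statements merged into one kernel-verified Lean document; each statement's English description precedes it below -/
import Mathlib

section
/- Let 𝔞 be a proper ideal of R. Then R is 𝔞-relative regular (𝔞 is generated by an R-regular sequence of length cd(𝔞,R)) if and only if grade(𝔞,R) = μ(𝔞), where μ(𝔞) is the minimal number of generators of 𝔞. -/
open CategoryTheory Opposite
open scoped TensorProduct

universe u

variable (R : Type u) [CommRing R]

/-- The Ext module `Ext^i_R(R/a, M)` as an object of `ModuleCat R`. -/
noncomputable def relExt (a : Ideal R) (i : ℕ)
    (M : Type u) [AddCommGroup M] [Module R M] : ModuleCat R :=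
  ((Ext R (ModuleCat R) i).obj (op (ModuleCat.of R (R ⧸ a)))).obj (ModuleCat.of R M)

/-- `grade(a, M) = inf { i | Ext^i_R(R/a, M) ≠ 0 }`. -/
noncomputable def rgrade (a : Ideal R) (M : Type u) [AddCommGroup M] [Module R M] : ℕ :=
  sInf {i | Nontrivial (relExt R a i M)}

/-- The local cohomology module `H^i_a(M)` as an object of `ModuleCat R`. -/
noncomputable def localCoh (a : Ideal R) (i : ℕ)
    (M : Type u) [AddCommGroup M] [Module R M] : ModuleCat R :=
  (localCohomology a i).obj (ModuleCat.of R M)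

/-- `cd(a, M) = sup { i | H^i_a(M) ≠ 0 }` (cohomological dimension). -/
noncomputable def rcd (a : Ideal R) (M : Type u) [AddCommGroup M] [Module R M] : ℕ :=
  sSup {i | Nontrivial (localCoh R a i M)}

/-- `M` is `a`-relative Cohen-Macaulay: `M = aM`, or `M ≠ aM` and
`grade(a,M) = cd(a,M)`. -/
def IsRelCM (a : Ideal R) (M : Type u) [AddCommGroup M] [Module R M] : Prop :=
  (a • (⊤ : Submodule R M) = ⊤) ∨
    (a • (⊤ : Submodule R M) ≠ ⊤ ∧ rgrade R a M = rcd R a M)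

/-- `ara(a, M)`: the arithmetic rank of `a` with respect to `M`. -/
noncomputable def ara (a : Ideal R) (M : Type u) [AddCommGroup M] [Module R M] : ℕ :=
  sInf {n | ∃ x : Fin n → R,
    (Ideal.span (Set.range x) + Module.annihilator R M).radical
      = (a + Module.annihilator R M).radical}

/-- Projective dimension of `M`, characterized by Ext-vanishing, valued in `ℕ∞`. -/
noncomputable def rpd (M : Type u) [AddCommGroup M] [Module R M] : ℕ∞ :=
  sSup ((fun i : ℕ => (i : ℕ∞)) '' {i : ℕ | ∃ N : ModuleCat R,
    Nontrivial (((Ext R (ModuleCat R) i).obj (op (ModuleCat.of R M))).obj N)})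

/-- Injective dimension of `M`, characterized by Ext-vanishing, valued in `ℕ∞`. -/
noncomputable def rid (M : Type u) [AddCommGroup M] [Module R M] : ℕ∞ :=
  sSup ((fun i : ℕ => (i : ℕ∞)) '' {i : ℕ | ∃ N : ModuleCat R,
    Nontrivial (((Ext R (ModuleCat R) i).obj (op N)).obj (ModuleCat.of R M))})

/-- The `a`-relative injective dimension `a-id_R M = sup{i | Ext^i(R/a, M) ≠ 0}`,
valued in `ℕ∞`. -/
noncomputable def raid (a : Ideal R) (M : Type u) [AddCommGroup M] [Module R M] : ℕ∞ :=
  sSup ((fun i : ℕ => (i : ℕ∞)) '' {i : ℕ | Nontrivial (relExt R a i M)})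

/-- `μ(a)`: the minimal number of generators of the ideal `a`. -/
noncomputable def mu (a : Ideal R) : ℕ :=
  sInf {n | ∃ s : Finset R, s.card = n ∧ Ideal.span (↑s : Set R) = a}

/-- `R` is `a`-relative regular: `a` is generated by an `R`-regular sequence of
length `cd(a,R)`. -/
def IsRelRegularRing (a : Ideal R) : Prop :=
  ∃ rs : List R, RingTheory.Sequence.IsRegular R rs ∧ rs.length = rcd R a R ∧
    Ideal.ofList rs = a

/-- `M` is an `a`-relative regular module: `M = aM`, or `M ≠ aM` and `a` is generated by
a sequence of length `cd(a,R)` that is both an `M`-regular and an `R`-regular sequence. -/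
def IsRelRegularMod (a : Ideal R) (M : Type u) [AddCommGroup M] [Module R M] : Prop :=
  (a • (⊤ : Submodule R M) = ⊤) ∨
    (a • (⊤ : Submodule R M) ≠ ⊤ ∧ ∃ rs : List R, rs.length = rcd R a R ∧
      Ideal.ofList rs = a ∧ RingTheory.Sequence.IsRegular M rs ∧
      RingTheory.Sequence.IsRegular R rs)

namespace S16
open Limits
section cmp
variable {R}
variable {X Y : ModuleCat.{u} R} (P : ProjectiveResolution X)

lemma extMk_zero_iff' {n : ℕ} (f : P.complex.X n ⟶ Y) (hf : P.complex.d (n+1) n ≫ f = 0) :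
    P.extMk f (n+1) rfl hf = 0 ↔ ∃ g : P.complex.X (n-1) ⟶ Y, P.complex.d n (n-1) ≫ g = f := by
  cases n with
  | succ n => exact P.extMk_eq_zero_iff f _ rfl hf n rfl
  | zero =>
    have hd : P.complex.d 0 (0-1) = 0 := P.complex.shape _ _ (by simp)
    rw [hd]
    constructor
    · intro h
      simp only [← P.extEquivCohomologyClass.apply_eq_iff_eq,
        ProjectiveResolution.extEquivCohomologyClass_extMk, 
        ProjectiveResolution.extEquivCohomologyClass_zero,
        CochainComplex.HomComplex.CohomologyClass.mk_eq_zero_iff] at h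
      rw [CochainComplex.HomComplex.Cocycle.toSingleMk_mem_coboundaries_iff _ _ _ _ _ 1 (by simp)] at h
      obtain ⟨g, hg⟩ := h
      have hz : IsZero (P.cochainComplex.X 1) := CochainComplex.isZero_of_isStrictlyLE _ 0 _
      rw [hz.eq_of_src g 0, comp_zero] at hg
      refine ⟨0, ?_⟩
      rw [comp_zero, ← cancel_epi (P.cochainComplexXIso (-(0:ℕ)) 0 rfl).hom, comp_zero]
      exact hg
    · rintro ⟨g, hg⟩
      have : f = 0 := by rw [← hg, zero_comp]
      subst this
      simp

/-- every cocycle is a coboundary -/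
def CB (P : ProjectiveResolution X) (Y : ModuleCat.{u} R) (n : ℕ) : Prop :=
  ∀ f : P.complex.X n ⟶ Y, P.complex.d (n+1) n ≫ f = 0 →
      ∃ g : P.complex.X (n-1) ⟶ Y, P.complex.d n (n-1) ≫ g = f

lemma new_iff (n : ℕ) : Subsingleton (Abelian.Ext X Y n) ↔ CB P Y n := by
  constructor
  · intro h f hf
    exact (extMk_zero_iff' P f hf).1 (Subsingleton.elim _ _)
  · intro h
    refine subsingleton_of_forall_eq 0 fun e => ?_
    obtain ⟨f, hf, rfl⟩ := P.extMk_surjective e (n+1) rfl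
    exact (extMk_zero_iff' P f hf).2 (h f hf)

lemma prev_up (n : ℕ) : (ComplexShape.up ℕ).prev n = n - 1 := by
  cases n with
  | zero => simp
  | succ n => simp

lemma old_iff (n : ℕ) : IsZero (((Ext R (ModuleCat R) n).obj (op X)).obj Y) ↔ CB P Y n := by
  rw [(P.isoExt (R := R) n Y).isZero_iff, ← HomologicalComplex.exactAt_iff_isZero_homology,
    HomologicalComplex.exactAt_iff' _ (n-1) n (n+1) (prev_up n) (by simp),
    ShortComplex.moduleCat_exact_iff]
  rfl

lemma old_new (n : ℕ) : Subsingleton (((Ext R (ModuleCat R) n).obj (op X)).obj Y) ↔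
    Subsingleton (Abelian.Ext X Y n) := by
  rw [← ModuleCat.isZero_iff_subsingleton, old_iff (projectiveResolution X), new_iff (projectiveResolution X)]

lemma mono_homology {K L : CochainComplex (ModuleCat.{u} R) ℕ} (φ : K ⟶ L) (n : ℕ)
    (h : ∀ x : K.X n, K.d n (n+1) x = 0 → (∃ y : L.X (n-1), L.d (n-1) n y = φ.f n x) →
      ∃ y : K.X (n-1), K.d (n-1) n y = x) : Mono (HomologicalComplex.homologyMap φ n) := by
  rw [HomologicalComplex.mono_homologyMap_iff_up_to_refinements φ (n-1) n (n+1) (prev_up n) (by simp)]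
  intro A x hx y hy
  have key : ∀ a, x a ∈ LinearMap.range (K.d (n-1) n).hom := by
    intro a
    refine h _ (by rw [← ConcreteCategory.comp_apply, hx]; rfl) ⟨y a, ?_⟩
    rw [← ConcreteCategory.comp_apply, ← ConcreteCategory.comp_apply, hy]
  refine ⟨Projective.over A, Projective.π A, inferInstance, ?_⟩
  have hP : Projective (Projective.over A : ModuleCat.{u} R) := inferInstance
  have : Module.Projective R ((Projective.over A : ModuleCat.{u} R) : Type u) := by
    rw [IsProjective.iff_projective]; exact hP
  obtain ⟨l, hl⟩ := Module.projective_lifting_property (K.d (n-1) n).hom.rangeRestrict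
    ((x.hom.comp (Projective.π A).hom).codRestrict _ (fun a => key _)) 
    (LinearMap.surjective_rangeRestrict _)
  refine ⟨ModuleCat.ofHom l, ?_⟩
  ext a
  have := congrArg Subtype.val (LinearMap.congr_fun hl a)
  exact this.symm

lemma epi_of_sq {C : Type*} [Category C] {A B A' B' : C} {f : A ⟶ B} {g : A' ⟶ B'} {j : B ≅ B'} {i : A ≅ A'}
    (h : f ≫ j.hom = i.hom ≫ g) (hg : Epi g) : Epi f := by
  have : Epi (f ≫ j.hom) := by rw [h]; exact epi_comp _ _
  exact (epi_comp_iff_of_isIso _ j.hom).1 this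

lemma old_inj {X' : ModuleCat.{u} R} (g : X' ⟶ X) (n : ℕ)
    (h : ∀ e : Abelian.Ext X Y n, (Abelian.Ext.mk₀ g).comp e (zero_add n) = 0 → e = 0) :
    Mono (((Ext R (ModuleCat R) n).map g.op).app Y) := by
  let P := projectiveResolution X
  let P' := projectiveResolution X'
  let F := ((linearYoneda R (ModuleCat.{u} R)).obj Y).rightOp
  let φ : P'.complex ⟶ P.complex := ProjectiveResolution.lift g P' P
  have w : φ ≫ P.π = P'.π ≫ (ChainComplex.single₀ _).map g := ProjectiveResolution.lift_commutes g P' P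
  let Φ : ProjectiveResolution.Hom P' P g := ⟨φ, by
    rw [← HomologicalComplex.comp_f, w]; rfl⟩
  have e1 : ((Ext R (ModuleCat R) n).map g.op).app Y = ((F.leftDerived n).map g).unop := rfl
  rw [e1, Functor.leftDerived_map_eq F n g φ w]
  have e2 : Mono (HomologicalComplex.homologyMap 
     ((HomologicalComplex.unopFunctor _ _).map ((F.mapHomologicalComplex _).map φ).op) n) := by
    apply mono_homology
    rintro f hf ⟨y, hy⟩
    have hf' : P.complex.d (n+1) n ≫ (f : P.complex.X n ⟶ Y) = 0 := hf
    have hy' : P'.complex.d n (n-1) ≫ (y : P'.complex.X (n-1) ⟶ Y) = φ.f n ≫ (f : P.complex.X n ⟶ Y) := hy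
    have := h (P.extMk f (n+1) rfl hf') (by
      rw [ProjectiveResolution.mk₀_comp_extMk f _ rfl hf' Φ]
      exact (extMk_zero_iff' P' _ _).2 ⟨y, hy'⟩)
    exact (extMk_zero_iff' P f hf').1 this
  have e3 := HomologicalComplex.homologyOp_hom_naturality 
     ((HomologicalComplex.unopFunctor _ _).map ((F.mapHomologicalComplex _).map φ).op) n
  have e5 : Epi ((HomologicalComplex.homologyMap 
     ((HomologicalComplex.unopFunctor _ _).map ((F.mapHomologicalComplex _).map φ).op) n).op) := inferInstance
  have e4 : Epi ((F.mapHomologicalComplex _ ⋙ HomologicalComplex.homologyFunctor _ (ComplexShape.down ℕ) n).map φ) := by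
    exact epi_of_sq e3 e5
  have : Epi ((P'.isoLeftDerivedObj F n).hom ≫
        (F.mapHomologicalComplex (ComplexShape.down ℕ) ⋙
                HomologicalComplex.homologyFunctor (ModuleCat R)ᵒᵖ (ComplexShape.down ℕ) n).map
            φ ≫
          (P.isoLeftDerivedObj F n).inv) := epi_comp _ _
  exact unop_mono_of_epi _
end cmp
end S16

namespace S16
open Limits
section ext
open Abelian RingTheory.Sequence
variable {R}

lemma hom_ss {N P Q : Type*} [AddCommGroup N] [Module R N] [AddCommGroup P] [Module R P] [AddCommGroup Q] [Module R Q]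
    (e : P ≃ₗ[R] Q) (h : Subsingleton (N →ₗ[R] P)) : Subsingleton (N →ₗ[R] Q) :=
  subsingleton_of_forall_eq 0 fun f => by
    ext x
    have := LinearMap.congr_fun (Subsingleton.elim (e.symm.toLinearMap.comp f) 0) x
    simpa using this

lemma ext_quot (N M : ModuleCat.{u} R) (r : R) (hr : IsSMulRegular M r) (i : ℕ)
    (h0 : Subsingleton (Ext N M i)) (h1 : Subsingleton (Ext N M (i+1))) :
    Subsingleton (Ext N (ModuleCat.of R (QuotSMulTop r M)) i) := by
  have zero1 := AddCommGrpCat.isZero_of_iff_subsingleton.mpr h0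
  have zero2 := AddCommGrpCat.isZero_of_iff_subsingleton.mpr h1
  exact AddCommGrpCat.subsingleton_of_isZero <| ShortComplex.Exact.isZero_of_both_zeros
        ((Ext.covariant_sequence_exact₃' N hr.smulShortComplex_shortExact) i (i + 1) rfl)
        (zero1.eq_zero_of_src _) (zero2.eq_zero_of_tgt _)

lemma comp_kill (N M : ModuleCat.{u} R) (r : R) (hr : r ∈ Module.annihilator R N) (i : ℕ) (e : Ext N M i) :
    e.comp (Ext.mk₀ (r • 𝟙 M)) (add_zero _) = 0 := by
  have h0 : r • 𝟙 N = 0 := by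
    simp [← ModuleCat.lsmul_eq_smul_id, Module.mem_annihilator_iff_lsmul_eq_zero.mp hr]
  have smul_eq : r • e = (Ext.mk₀ (r • 𝟙 N)).comp e (zero_add i) := by simp [Ext.mk₀_smul]
  rw [Ext.mk₀_smul, Ext.comp_smul, Ext.comp_mk₀_id, smul_eq, h0, Ext.mk₀_zero, Ext.zero_comp]

lemma L1 (rs : List R) (N : ModuleCat.{u} R) (hN : ∀ r ∈ rs, r ∈ Module.annihilator R N) :
    ∀ (M : ModuleCat.{u} R) (_ : IsWeaklyRegular M rs) (i : ℕ) (_ : i < rs.length),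
      Subsingleton (Ext N M i) := by
  induction rs with
  | nil => simp
  | cons r rs ih =>
    intro M hM i hi
    rw [isWeaklyRegular_cons_iff] at hM
    cases i with
    | zero => 
      have : Subsingleton (N →ₗ[R] M) := 
        hM.1.linearMap_subsingleton_of_mem_annihilator (hN r (by simp))
      exact (Ext.addEquiv₀.trans ModuleCat.homAddEquiv).subsingleton
    | succ i =>
      have := ih (fun s hs => hN s (by simp [hs])) (ModuleCat.of R (QuotSMulTop r M)) hM.2 i
        (by simpa using hi)
      refine subsingleton_of_forall_eq 0 fun e => ?_
      have hz : e.comp (Ext.mk₀ (M.smulShortComplex r).f) (add_zero _) = 0 := by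
        exact comp_kill N M r (hN r (by simp)) (i+1) e
      obtain ⟨x, hx⟩ := Ext.covariant_sequence_exact₁ N hM.1.smulShortComplex_shortExact e hz rfl
      have hx0 : x = 0 := @Subsingleton.elim _ this x 0
      rw [← hx, hx0, Ext.zero_comp]
      rfl

lemma L2 (rs : List R) (N : ModuleCat.{u} R) (hN : ∀ r ∈ rs, r ∈ Module.annihilator R N) :
    ∀ (M : ModuleCat.{u} R) (_ : IsWeaklyRegular M rs) (_ : Subsingleton (Ext N M rs.length)),
      Subsingleton (N →ₗ[R] (M ⧸ (Ideal.ofList rs • ⊤ : Submodule R M))) := by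
  induction rs with
  | nil =>
    intro M _ h
    have : Subsingleton (N →ₗ[R] M) :=
      (Ext.addEquiv₀.trans ModuleCat.homAddEquiv).symm.subsingleton
    let e : (M ⧸ (Ideal.ofList ([] : List R) • ⊤ : Submodule R M)) ≃ₗ[R] M :=
      Submodule.quotEquivOfEqBot _ (by rw [Ideal.ofList_nil]; exact Submodule.bot_smul (R := R) _)
    exact hom_ss e.symm this
  | cons r rs ih =>
    intro M hM h
    have h0 := L1 (r :: rs) N hN M hM rs.length (by simp)
    rw [isWeaklyRegular_cons_iff] at hM
    have := ih (fun s hs => hN s (by simp [hs])) (ModuleCat.of R (QuotSMulTop r M)) hM.2 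
      (ext_quot N M r hM.1 _ h0 h)
    exact hom_ss (Submodule.quotOfListConsSMulTopEquivQuotSMulTopInner M r rs).symm this

lemma ann_quot (a : Ideal R) (r : R) (h : r ∈ a) : r ∈ Module.annihilator R (ModuleCat.of R (R ⧸ a)) := by
  change r ∈ Module.annihilator R (R ⧸ a)
  rwa [Ideal.annihilator_quotient]

lemma ext_top (rs : List R) (hrs : IsWeaklyRegular R rs) (h : Ideal.ofList rs ≠ ⊤) :
    ¬ Subsingleton (Ext (ModuleCat.of R (R ⧸ Ideal.ofList rs)) (ModuleCat.of R R) rs.length) := by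
  intro hs
  have := L2 rs (ModuleCat.of R (R ⧸ Ideal.ofList rs)) (fun r hr => ann_quot _ _ (Ideal.subset_span hr))
    (ModuleCat.of R R) hrs hs
  have h1 : (Ideal.ofList rs • ⊤ : Submodule R R) = Ideal.ofList rs := by simp
  have := hom_ss (N := R ⧸ Ideal.ofList rs) (Submodule.quotEquivOfEq (Ideal.ofList rs • ⊤ : Submodule R R) (Ideal.ofList rs) h1) this
  have h2 := LinearMap.congr_fun (this.elim LinearMap.id 0) 1
  apply h
  rw [Ideal.eq_top_iff_one, ← Ideal.Quotient.eq_zero_iff_mem]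
  exact h2

/-- injectivity -/
lemma precomp_inj [IsNoetherianRing R] (a : Ideal R) (rs : List R) (hrs : IsRegular R rs) (ha : Ideal.ofList rs = a)
    {A B : ModuleCat.{u} R} [Module.Finite R A] (g : A ⟶ B) [Epi g] 
    (hA : Module.support R A ⊆ PrimeSpectrum.zeroLocus a)
    (e : Ext B (ModuleCat.of R R) rs.length)
    (he : (Ext.mk₀ g).comp e (zero_add _) = 0) : e = 0 := by
  generalize hn : rs.length = n at *
  cases n with
  | zero =>
    obtain ⟨f, rfl⟩ := (Ext.mk₀_bijective _ _).2 e
    rw [Ext.mk₀_comp_mk₀] at he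
    rw [← Ext.mk₀_zero] at he ⊢
    have := (Ext.mk₀_bijective _ _).1 he
    congr 1
    rw [← cancel_epi g, this, comp_zero]
  | succ n =>
    let S := g.hom.shortComplexKer
    have hS : S.ShortExact := LinearMap.shortExact_shortComplexKer ((ModuleCat.epi_iff_surjective g).1 inferInstance)
    obtain ⟨x, hx⟩ := Ext.contravariant_sequence_exact₃ hS (ModuleCat.of R R) e he (n₀ := n) (by omega)
    have hfin : Module.Finite R S.X₁ := inferInstanceAs (Module.Finite R (LinearMap.ker g.hom))
    have hsup : Module.support R S.X₁ ⊆ PrimeSpectrum.zeroLocus a := by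
      refine (Module.support_subset_of_injective (M := LinearMap.ker g.hom) (LinearMap.ker g.hom).subtype (Submodule.injective_subtype _)).trans hA
    have htop : a • (⊤ : Submodule R (ModuleCat.of R R)) < ⊤ := by
      rw [← ha]
      exact hrs.2.symm.lt_top
    have := ModuleCat.subsingleton_ext_of_exists_isRegular a S.X₁ hsup (ModuleCat.of R R) htop rs 
      (fun r hr => ha ▸ Ideal.subset_span hr) hrs n (by omega)
    rw [← hx, Subsingleton.elim x 0, Ext.comp_zero]
end ext
end S16

namespace S16
open Limits
section kap
open Abelian RingTheory.Sequence
variable {R}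

lemma coset (n : ℕ) : ∀ (s : Finset (Ideal R)) (_ : s.card = n) (_ : ∀ P ∈ s, P.IsPrime) (x : R) (J : Ideal R)
    (_ : ∀ P ∈ s, x ∈ P → ¬ J ≤ P), ∃ j ∈ J, ∀ P ∈ s, x + j ∉ P := by
  classical
  induction n with
  | zero =>
    intro s hs _ x J _
    rw [Finset.card_eq_zero] at hs
    exact ⟨0, J.zero_mem, by simp [hs]⟩
  | succ n ih =>
    intro s hs hp x J h
    obtain ⟨P, hP⟩ := s.exists_minimal (Finset.card_pos.1 (by omega))
    obtain ⟨j, hj, hjs⟩ := ih (s.erase P) (by rw [Finset.card_erase_of_mem hP.1]; omega)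
      (fun Q hQ => hp Q (Finset.mem_of_mem_erase hQ)) x J (fun Q hQ => h Q (Finset.mem_of_mem_erase hQ))
    by_cases hx : x + j ∈ P
    · have hJ : ¬ J ≤ P := fun hJ => h P hP.1 (by simpa using P.sub_mem hx (hJ hj)) hJ
      have hPp := hp P hP.1
      have hK : ¬ J * ∏ Q ∈ s.erase P, Q ≤ P := by
        rw [hPp.mul_le, hPp.prod_le]
        rintro (h1 | ⟨Q, hQ, h1⟩)
        · exact hJ h1
        · have := hP.2 (Finset.mem_of_mem_erase hQ) h1
          exact Finset.ne_of_mem_erase hQ (le_antisymm h1 this)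
      obtain ⟨t, ht, htP⟩ := SetLike.not_le_iff_exists.1 hK
      refine ⟨j + t, J.add_mem hj ((show J * ∏ Q ∈ s.erase P, Q ≤ J from Ideal.mul_le_left) ht), fun Q hQ hxQ => ?_⟩
      by_cases hQP : Q = P
      · subst hQP
        apply htP
        have := Q.sub_mem hxQ hx
        simpa [add_assoc] using this
      · have hQ' := Finset.mem_erase.2 ⟨hQP, hQ⟩
        apply hjs Q hQ'
        have : t ∈ Q := by
          have h1 : J * ∏ Q ∈ s.erase P, Q ≤ ∏ Q ∈ s.erase P, Q := Ideal.mul_le_right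
          have h2 : ∏ Q ∈ s.erase P, Q ≤ (s.erase P).inf (fun Q => Q) := Ideal.prod_le_inf
          have h3 : (s.erase P).inf (fun Q => Q) ≤ Q := Finset.inf_le hQ'
          exact h3 (h2 (h1 ht))
        have := Q.sub_mem hxQ this
        rwa [← add_assoc, add_sub_cancel_right] at this
    · refine ⟨j, hj, fun Q hQ => ?_⟩
      by_cases hQP : Q = P
      · rwa [hQP]
      · exact hjs Q (Finset.mem_erase.2 ⟨hQP, hQ⟩)

lemma kap [IsNoetherianRing R] (a : Ideal R) (xs : List R) : ∀ (M : ModuleCat.{u} R) (_ : Module.Finite R M) (I : Ideal R)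
    (_ : I ⊔ Ideal.ofList xs = a) (_ : I ≤ Module.annihilator R M) 
    (_ : ∀ i < xs.length, Subsingleton (Ext (ModuleCat.of R (R ⧸ a)) M i)), 
    ∃ zs : List R, zs.length = xs.length ∧ IsWeaklyRegular M zs ∧ I ⊔ Ideal.ofList zs = a := by
  induction xs with
  | nil => 
    intro M _ I hI _ _
    exact ⟨[], rfl, IsWeaklyRegular.nil _ _, hI⟩
  | cons x xs ih =>
    intro M hM I hI hIM h
    have h0 : Subsingleton ((R ⧸ a) →ₗ[R] M) := by
      have := h 0 (by simp)
      exact (Ext.addEquiv₀.trans (ModuleCat.homAddEquiv (M := ModuleCat.of R (R ⧸ a)) (N := M))).symm.subsingleton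
    obtain ⟨r, hr, hreg⟩ := IsSMulRegular.subsingleton_linearMap_iff.1 h0
    rw [Ideal.annihilator_quotient] at hr
    have hass := biUnion_associatedPrimes_eq_compl_regular R M
    have hnot : ∀ P ∈ associatedPrimes R M, r ∉ P := by
      intro P hP hrP
      have : r ∈ ⋃ p ∈ associatedPrimes R M, (p : Set R) := Set.mem_biUnion hP hrP
      rw [hass] at this
      exact this hreg
    obtain ⟨j, hj, hjP⟩ := coset _ (associatedPrimes.finite R M).toFinset rfl (fun P hP => 
      IsAssociatedPrime.isPrime ((Set.Finite.mem_toFinset _).1 hP)) x (Ideal.ofList xs) (by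
      intro P hP hx hJ
      rw [Set.Finite.mem_toFinset] at hP
      apply hnot P hP
      have hle : a ≤ P := by
        rw [← hI, Ideal.ofList_cons]
        refine sup_le (hIM.trans ?_) (sup_le ?_ hJ)
        · rw [← Submodule.annihilator_top]; exact IsAssociatedPrime.annihilator_le hP
        · rwa [Ideal.span_singleton_le_iff_mem]
      exact hle hr)
    have hz : IsSMulRegular M (x + j) := by
      by_contra hc
      have : x + j ∈ ⋃ p ∈ associatedPrimes R M, (p : Set R) := by
        rw [hass]; exact hc
      simp only [Set.mem_iUnion] at this
      obtain ⟨P, hP, hh⟩ := this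
      exact hjP P ((Set.Finite.mem_toFinset _).2 hP) hh
    have hspan : Ideal.span {x + j} ⊔ Ideal.ofList xs = Ideal.span {x} ⊔ Ideal.ofList xs := by
      apply le_antisymm
      · refine sup_le ?_ le_sup_right
        rw [Ideal.span_singleton_le_iff_mem]
        exact Submodule.add_mem_sup (Ideal.mem_span_singleton_self x) hj
      · refine sup_le ?_ le_sup_right
        rw [Ideal.span_singleton_le_iff_mem]
        have := Submodule.sub_mem _ (Submodule.mem_sup_left (T := Ideal.ofList xs) (Ideal.mem_span_singleton_self (x + j)))
           (Submodule.mem_sup_right (S := Ideal.span {x+j}) hj)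
        simpa using this
    obtain ⟨zs, hl, hw, hzs⟩ := ih (ModuleCat.of R (QuotSMulTop (x + j) M)) 
      (inferInstanceAs (Module.Finite R (QuotSMulTop (x + j) M))) (I ⊔ Ideal.span {x + j})
      (by rw [sup_assoc, hspan, ← hI, Ideal.ofList_cons]) (by
        refine sup_le (fun y hy => ?_) ?_
        · change y ∈ Module.annihilator R (QuotSMulTop (x + j) M)
          rw [Module.mem_annihilator]
          intro m
          obtain ⟨m, rfl⟩ := Submodule.mkQ_surjective _ m
          rw [← map_smul, Module.mem_annihilator.1 (hIM hy), map_zero]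
        · rw [Ideal.span_singleton_le_iff_mem]
          change _ ∈ Module.annihilator R (QuotSMulTop (x + j) M)
          rw [Module.mem_annihilator]
          intro m
          obtain ⟨m, rfl⟩ := Submodule.mkQ_surjective _ m
          rw [← map_smul, Submodule.mkQ_apply, Submodule.Quotient.mk_eq_zero]
          exact Submodule.smul_mem_pointwise_smul _ _ _ trivial)
      (fun i hi => ext_quot _ M _ hz i (h i (by simp; omega)) (h (i+1) (by simp; omega)))
    exact ⟨(x + j) :: zs, by simp [hl], IsWeaklyRegular.cons hz hw, by rw [Ideal.ofList_cons, ← sup_assoc, hzs]⟩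
end kap
end S16

namespace S16
open Limits
section pow
open Abelian RingTheory.Sequence
variable {R}

lemma wr_ses (rs : List R) : ∀ (A B C : Type u) [AddCommGroup A] [AddCommGroup B] [AddCommGroup C]
    [Module R A] [Module R B] [Module R C] (f : A →ₗ[R] B) (g : B →ₗ[R] C) (_ : Function.Injective f) 
    (_ : Function.Exact f g) (_ : Function.Surjective g) (_ : IsWeaklyRegular A rs) (_ : IsWeaklyRegular C rs),
    IsWeaklyRegular B rs := by
  induction rs with
  | nil => intros; exact IsWeaklyRegular.nil _ _
  | cons r rs ih =>
    intro A B C _ _ _ _ _ _ f g hf hfg hg hA hC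
    rw [isWeaklyRegular_cons_iff] at *
    refine ⟨isSMulRegular_of_range_eq_ker hf hfg.linearMap_ker_eq.symm hA.1 hC.1, ?_⟩
    refine ih _ _ _ (QuotSMulTop.map r f) (QuotSMulTop.map r g) ?_ (QuotSMulTop.map_exact r hfg hg) 
      (QuotSMulTop.map_surjective r hg) hA.2 hC.2
    have h0 : Function.Exact (0 : PUnit.{u+1} →ₗ[R] A) f := by
      rw [LinearMap.exact_zero_iff_injective]; exact hf
    have := QuotSMulTop.map_first_exact_on_four_term_exact_of_isSMulRegular_last h0 hfg hC.1
    rw [← LinearMap.ker_eq_bot, this.linearMap_ker_eq]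
    rw [LinearMap.range_eq_bot]
    ext x
    simp 

open scoped Pointwise in
lemma pow1 (r : R) (rs : List R) (M : Type u) [AddCommGroup M] [Module R M] (hr : IsSMulRegular M r)
    (h : IsWeaklyRegular (QuotSMulTop r M) rs) (k : ℕ) : IsWeaklyRegular (QuotSMulTop (r^(k+1)) M) rs := by
  induction k with
  | zero => rw [zero_add, pow_one]; exact h
  | succ k ih =>
    let f : QuotSMulTop (r^(k+1)) M →ₗ[R] QuotSMulTop (r^(k+1+1)) M :=
      Submodule.mapQ _ _ (LinearMap.lsmul R M r) (by
        rintro _ ⟨m, -, rfl⟩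
        refine ⟨m, trivial, ?_⟩
        simp [pow_succ' r (k+1), mul_smul, smul_comm r])
    let g : QuotSMulTop (r^(k+1+1)) M →ₗ[R] QuotSMulTop r M :=
      Submodule.mapQ _ _ LinearMap.id (by
        rintro _ ⟨m, -, rfl⟩
        refine ⟨r^(k+1) • m, trivial, ?_⟩
        simp [pow_succ' r (k+1), mul_smul, smul_comm _ r])
    refine wr_ses rs _ _ _ f g ?_ ?_ ?_ ih h
    · rw [← LinearMap.ker_eq_bot, LinearMap.ker_eq_bot']
      intro m hm
      obtain ⟨m, rfl⟩ := Submodule.mkQ_surjective _ m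
      rw [Submodule.mkQ_apply, Submodule.Quotient.mk_eq_zero]
      have hm' : Submodule.mkQ (r^(k+1+1) • (⊤ : Submodule R M)) (r • m) = 0 := hm
      rw [Submodule.mkQ_apply, Submodule.Quotient.mk_eq_zero] at hm'
      obtain ⟨y, -, hy⟩ := hm'
      refine ⟨y, trivial, hr ?_⟩
      change r ^ (k+1+1) • y = r • m at hy
      change r • (r^(k+1) • y) = r • m
      rw [← hy, pow_succ' r (k+1), mul_smul]
    · intro m
      obtain ⟨m, rfl⟩ := Submodule.mkQ_surjective _ m
      constructor
      · intro hm
        have hm' : Submodule.mkQ (r • (⊤ : Submodule R M)) m = 0 := hm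
        rw [Submodule.mkQ_apply, Submodule.Quotient.mk_eq_zero] at hm'
        obtain ⟨y, -, hy⟩ := hm'
        exact ⟨Submodule.mkQ _ y, congrArg (Submodule.mkQ _) hy⟩
      · rintro ⟨y, hy⟩
        obtain ⟨y, rfl⟩ := Submodule.mkQ_surjective _ y
        rw [← hy]
        change Submodule.mkQ (r • (⊤ : Submodule R M)) (r • y) = 0
        rw [Submodule.mkQ_apply, Submodule.Quotient.mk_eq_zero]
        exact Submodule.smul_mem_pointwise_smul _ _ _ trivial
    · intro m
      obtain ⟨m, rfl⟩ := Submodule.mkQ_surjective _ m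
      exact ⟨Submodule.mkQ _ m, rfl⟩

lemma wr_pow (k : ℕ) (rs : List R) : ∀ (M : Type u) [AddCommGroup M] [Module R M] (_ : IsWeaklyRegular M rs),
    IsWeaklyRegular M (rs.map (· ^ (k+1))) := by
  induction rs with
  | nil => intros; exact IsWeaklyRegular.nil _ _
  | cons r rs ih =>
    intro M _ _ h
    rw [isWeaklyRegular_cons_iff] at h
    exact IsWeaklyRegular.cons (h.1.pow _) (pow1 r _ M h.1 (ih _ h.2) k)

lemma pd_le (rs : List R) : ∀ (M : ModuleCat.{u} R) (d : ℕ) (_ : HasProjectiveDimensionLT M d) (_ : IsWeaklyRegular M rs),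
    HasProjectiveDimensionLT (ModuleCat.of R (M ⧸ (Ideal.ofList rs • ⊤ : Submodule R M))) (d + rs.length) := by
  induction rs with
  | nil =>
    intro M d hd _
    let e : (M ⧸ (Ideal.ofList ([] : List R) • ⊤ : Submodule R M)) ≃ₗ[R] M :=
      Submodule.quotEquivOfEqBot _ (by rw [Ideal.ofList_nil]; exact Submodule.bot_smul (R := R) _)
    exact hasProjectiveDimensionLT_of_iso (e.symm.toModuleIso) d
  | cons r rs ih =>
    intro M d hd h
    rw [isWeaklyRegular_cons_iff] at h
    have h1 : HasProjectiveDimensionLT (ModuleCat.of R (QuotSMulTop r M)) (d + 1) :=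
      h.1.smulShortComplex_shortExact.hasProjectiveDimensionLT_X₃ d hd (@hasProjectiveDimensionLT_of_ge _ _ _ M d _ (by omega) hd)
    have h2 := ih _ _ h1 h.2
    have h3 := have := h2; hasProjectiveDimensionLT_of_iso ((Submodule.quotOfListConsSMulTopEquivQuotSMulTopInner M r rs).symm.toModuleIso) (d + 1 + rs.length)
    rw [List.length_cons, show d + (rs.length + 1) = d + 1 + rs.length by omega]
    exact h3

lemma ext_vanish (rs : List R) (h : IsWeaklyRegular R rs) (Y : ModuleCat.{u} R) (i : ℕ) (hi : rs.length < i) :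
    Subsingleton (Ext (ModuleCat.of R (R ⧸ Ideal.ofList rs)) Y i) := by
  have h0 : HasProjectiveDimensionLT (ModuleCat.of R R) 1 := by
    have : Projective (ModuleCat.of R R) := inferInstance
    infer_instance
  have h1 := pd_le rs (ModuleCat.of R R) 1 h0 h
  have h2 : HasProjectiveDimensionLT (ModuleCat.of R (R ⧸ Ideal.ofList rs)) (1 + rs.length) :=
    have := h1; hasProjectiveDimensionLT_of_iso ((Submodule.quotEquivOfEq (Ideal.ofList rs • ⊤ : Submodule R R) (Ideal.ofList rs) (by simp)).toModuleIso) _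
  exact HasProjectiveDimensionLT.subsingleton _ (1 + rs.length) i (by omega) Y

lemma ofList_pow_le (rs : List R) (k : ℕ) : ∃ m, (Ideal.ofList rs)^m ≤ Ideal.ofList (rs.map (· ^ (k+1))) ∧ 
    Ideal.ofList (rs.map (· ^ (k+1))) ≤ (Ideal.ofList rs)^k := by
  have h1 : Ideal.ofList (rs.map (· ^ (k+1))) ≤ (Ideal.ofList rs)^k := by
    rw [Ideal.ofList, Ideal.span_le]
    intro x hx
    obtain ⟨y, hy, rfl⟩ := List.mem_map.1 hx
    exact Ideal.pow_le_pow_right (Nat.le_succ k) (Ideal.pow_mem_pow (show y ∈ Ideal.ofList rs from Ideal.subset_span hy) _)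
  have h2 : Ideal.ofList rs ≤ (Ideal.ofList (rs.map (· ^ (k+1)))).radical := by
    rw [Ideal.ofList, Ideal.span_le]
    intro x hx
    exact ⟨k+1, Ideal.subset_span (α := R) (show x ^ (k+1) ∈ {r | r ∈ rs.map (· ^ (k+1))} from List.mem_map.2 ⟨x, hx, rfl⟩)⟩
  classical
  obtain ⟨m, hm⟩ := Ideal.exists_pow_le_of_le_radical_of_fg h2 ⟨rs.toFinset, by simp [Ideal.ofList]⟩
  exact ⟨m, hm, h1⟩
end pow
end S16

namespace S16
open Limits
section lc
open Abelian RingTheory.Sequence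
variable {R}

/-- the evaluated diagram -/
noncomputable def FD (a : Ideal R) (i : ℕ) : ℕᵒᵖᵒᵖ ⥤ ModuleCat.{u} R :=
  localCohomology.diagram (localCohomology.idealPowersDiagram a) i ⋙ (evaluation _ _).obj (ModuleCat.of R R)

noncomputable def lcIso (a : Ideal R) (i : ℕ) : 
    (localCohomology a i).obj (ModuleCat.of R R) ≅ colimit (FD a i) :=
  have := localCohomology.hasColimitDiagram.{u, 0} (localCohomology.idealPowersDiagram a) i
  colimitObjIsoColimitCompEvaluation (localCohomology.diagram (localCohomology.idealPowersDiagram a) i) (ModuleCat.of R R)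

lemma lc_nontriv [IsNoetherianRing R] (rs : List R) (hrs : IsRegular R rs) :
    ¬ Subsingleton ((localCohomology (Ideal.ofList rs) rs.length).obj (ModuleCat.of R R)) := by
  intro h
  have hc : IsZero (colimit (FD (Ideal.ofList rs) rs.length)) := 
    (lcIso _ _).isZero_iff.1 (ModuleCat.isZero_iff_subsingleton.2 h)
  have htop : Ideal.ofList rs ≠ ⊤ := fun h => hrs.2 (by rw [h]; simp)
  have h1 : ¬ Subsingleton ((FD (Ideal.ofList rs) rs.length).obj (op (op 1))) := by
    change ¬ Subsingleton (((_root_.Ext R (ModuleCat R) rs.length).obj (op (ModuleCat.of R (R ⧸ (Ideal.ofList rs)^1)))).obj (ModuleCat.of R R))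
    rw [pow_one, old_new]
    exact ext_top rs hrs.1 htop
  apply h1
  refine subsingleton_of_forall_eq 0 fun x => ?_
  have hx : colimit.ι (FD (Ideal.ofList rs) rs.length) (op (op 1)) x = 0 := by
    rw [hc.eq_zero_of_tgt (colimit.ι (FD (Ideal.ofList rs) rs.length) (op (op 1)))]
    rfl
  have hp : PreservesFilteredColimitsOfSize.{0, 0} (forget (ModuleCat.{u} R)) :=
    preservesFilteredColimitsOfSize_shrink.{0, u, 0, u} _
  have hp2 : PreservesColimitsOfShape ℕᵒᵖᵒᵖ (forget (ModuleCat.{u} R)) := 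
    hp.preserves_filtered_colimits _
  obtain ⟨k, f, hf⟩ := Concrete.colimit_rep_eq_zero (F := FD (Ideal.ofList rs) rs.length) (j := op (op 1)) (x := x) (hx := hx)
  let g := (localCohomology.ringModIdeals (localCohomology.idealPowersDiagram (Ideal.ofList rs))).map f.unop
  have hg : Epi g := by
    rw [ModuleCat.epi_iff_surjective]
    intro y
    obtain ⟨y, rfl⟩ := Submodule.mkQ_surjective _ y
    exact ⟨Submodule.mkQ _ y, rfl⟩
  have hm : Mono (((_root_.Ext R (ModuleCat R) rs.length).map g.op).app (ModuleCat.of R R)) := by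
    apply old_inj
    intro e he
    have hfin : Module.Finite R ((localCohomology.ringModIdeals (localCohomology.idealPowersDiagram (Ideal.ofList rs))).obj k.unop) :=
      inferInstanceAs (Module.Finite R (R ⧸ (Ideal.ofList rs)^(k.unop.unop)))
    refine precomp_inj (Ideal.ofList rs) rs hrs rfl g ?_ e he
    change Module.support R (R ⧸ (Ideal.ofList rs)^(k.unop.unop)) ⊆ _
    rw [Module.support_eq_zeroLocus, Ideal.annihilator_quotient]
    have hk : 1 ≤ k.unop.unop := leOfHom f.unop.unop
    rw [PrimeSpectrum.zeroLocus_pow _ (by omega)]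
  rw [ModuleCat.mono_iff_injective] at hm
  apply hm
  exact hf.trans (map_zero ((FD (Ideal.ofList rs) rs.length).map f).hom).symm

lemma lc_zero (rs : List R) (hrs : IsWeaklyRegular R rs) (i : ℕ) (hi : rs.length < i) :
    Subsingleton ((localCohomology (Ideal.ofList rs) i).obj (ModuleCat.of R R)) := by
  rw [← ModuleCat.isZero_iff_subsingleton, (lcIso _ _).isZero_iff, IsZero.iff_id_eq_zero]
  apply colimit.hom_ext
  intro j
  rw [Category.comp_id, comp_zero]
  obtain ⟨m, hm, hk⟩ := ofList_pow_le rs j.unop.unop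
  set b := Ideal.ofList (rs.map (· ^ (j.unop.unop + 1))) with hb
  let m' := max m j.unop.unop
  let f : j ⟶ op (op m') := (homOfLE (le_max_right m j.unop.unop)).op.op
  rw [← colimit.w _ f]
  have h0 : (FD (Ideal.ofList rs) i).map f = 0 := by
    let g1 : ModuleCat.of R (R ⧸ (Ideal.ofList rs)^m') ⟶ ModuleCat.of R (R ⧸ b) := 
      ModuleCat.ofHom <| Submodule.mapQ _ _ LinearMap.id ((Ideal.pow_le_pow_right (le_max_left _ _)).trans hm)
    let g2 : ModuleCat.of R (R ⧸ b) ⟶ ModuleCat.of R (R ⧸ (Ideal.ofList rs)^j.unop.unop) := 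
      ModuleCat.ofHom <| Submodule.mapQ _ _ LinearMap.id hk
    have e : (FD (Ideal.ofList rs) i).map f = 
      ((_root_.Ext R (ModuleCat R) i).map g2.op).app (ModuleCat.of R R) ≫ 
      ((_root_.Ext R (ModuleCat R) i).map g1.op).app (ModuleCat.of R R) := by
      rw [← NatTrans.comp_app, ← Functor.map_comp, ← op_comp]
      change ((_root_.Ext R (ModuleCat R) i).map ((localCohomology.ringModIdeals (localCohomology.idealPowersDiagram (Ideal.ofList rs))).map f.unop).op).app (ModuleCat.of R R) = _
      congr 3
      ext y
      obtain ⟨y, rfl⟩ := Submodule.mkQ_surjective _ y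
      rfl
    have hz : IsZero (((_root_.Ext R (ModuleCat R) i).obj (op (ModuleCat.of R (R ⧸ b)))).obj (ModuleCat.of R R)) := by
      rw [ModuleCat.isZero_iff_subsingleton, old_new]
      exact ext_vanish _ (wr_pow _ rs R hrs) _ _ (by simpa using hi)
    rw [e, hz.eq_zero_of_tgt (((_root_.Ext R (ModuleCat R) i).map g2.op).app (ModuleCat.of R R)), zero_comp]
    rfl
  rw [h0, zero_comp]
end lc
end S16

namespace S16
open Limits
section fin
open Abelian RingTheory.Sequence
variable {R}

lemma rcd_eq [IsNoetherianRing R] (rs : List R) (hrs : IsRegular R rs) :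
    rcd R (Ideal.ofList rs) R = rs.length := by
  apply IsGreatest.csSup_eq
  constructor
  · exact not_subsingleton_iff_nontrivial.1 (lc_nontriv rs hrs)
  · intro i hi
    by_contra hc
    exact not_subsingleton_iff_nontrivial.2 hi (lc_zero rs hrs.1 i (by omega))

lemma relExt_iff (a : Ideal R) (i : ℕ) : Nontrivial (relExt R a i R) ↔ 
    ¬ Subsingleton (Ext (ModuleCat.of R (R ⧸ a)) (ModuleCat.of R R) i) := by
  rw [← not_subsingleton_iff_nontrivial, ← old_new]
  rfl

lemma rgrade_eq (rs : List R) (hrs : IsRegular R rs) :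
    rgrade R (Ideal.ofList rs) R = rs.length := by
  apply IsLeast.csInf_eq
  constructor
  · exact (relExt_iff _ _).2 (ext_top rs hrs.1 fun h => hrs.2 (by rw [h]; simp))
  · intro i hi
    by_contra hc
    exact (relExt_iff _ _).1 hi (L1 rs _ (fun r hr => ann_quot _ _ (Ideal.subset_span hr)) _ hrs.1 i (by omega))

lemma kapR [IsNoetherianRing R] (a : Ideal R) (ha : a ≠ ⊤) (s : Finset R) (hs : Ideal.span (s : Set R) = a)
    (h : s.card ≤ rgrade R a R) : ∃ zs : List R, zs.length = s.card ∧ IsRegular R zs ∧ Ideal.ofList zs = a := by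
  obtain ⟨zs, h1, h2, h3⟩ := kap a s.toList (ModuleCat.of R R) (inferInstanceAs (Module.Finite R R)) ⊥
    (by rw [bot_sup_eq, ← hs, Ideal.ofList]; simp) bot_le (by
      intro i hi
      rw [Finset.length_toList] at hi
      have := Nat.notMem_of_lt_sInf (lt_of_lt_of_le hi h)
      by_contra hc
      exact this ((relExt_iff a i).2 hc))
  rw [bot_sup_eq] at h3
  refine ⟨zs, by simpa using h1, ⟨h2, ?_⟩, h3⟩
  rw [h3]
  simpa using ha.symm

lemma mu_spec [IsNoetherianRing R] (a : Ideal R) : ∃ s : Finset R, s.card = mu R a ∧ Ideal.span (s : Set R) = a := by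
  obtain ⟨s, hs⟩ := IsNoetherian.noetherian a
  exact Nat.sInf_mem (s := {n | ∃ s : Finset R, s.card = n ∧ Ideal.span (↑s : Set R) = a}) ⟨s.card, s, rfl, hs⟩

end fin
end S16

/-- `R` is `a`-relative regular iff `grade(a,R) = μ(a)`. -/
theorem stmt16 [IsNoetherianRing R] (a : Ideal R) (ha : a ≠ ⊤) :
    IsRelRegularRing R a ↔ rgrade R a R = mu R a := by
  obtain ⟨s, hsc, hs⟩ := S16.mu_spec a
  constructor
  · rintro ⟨rs, hrs, -, rfl⟩
    have h1 := S16.rgrade_eq rs hrs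
    have h2 : mu R (Ideal.ofList rs) ≤ rs.length := by
      classical
      refine le_trans (Nat.sInf_le ⟨rs.toFinset, rfl, ?_⟩) (List.toFinset_card_le rs)
      simp [Ideal.ofList]
    obtain ⟨zs, hl, hz, hza⟩ := S16.kapR _ ha s hs (by omega)
    have h3 := S16.rgrade_eq zs hz
    rw [hza] at h3
    omega
  · intro h
    obtain ⟨zs, hl, hz, hza⟩ := S16.kapR _ ha s hs (by omega)
    refine ⟨zs, hz, ?_, hza⟩
    rw [← hza, S16.rcd_eq zs hz]
end

section
/- Let 𝔞 be an ideal of R contained in its Jacobson radical and M a nonzero finitely generated R-module. Then M is 𝔞-relative regular if and only if grade(𝔞,M) = grade(𝔞,R) = μ(𝔞). -/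
open CategoryTheory Opposite
open scoped TensorProduct

universe u

variable (R : Type u) [CommRing R]

namespace RelReg
open RingTheory.Sequence
variable {R}


theorem coset_avoid (S : Finset (Ideal R)) (hS : ∀ P ∈ S, P.IsPrime) (x : R) (I : Ideal R)
    (h : ∀ P ∈ S, ¬ (x ∈ P ∧ I ≤ P)) : ∃ c ∈ I, ∀ P ∈ S, x + c ∉ P := by
  classical
  induction hn : S.card generalizing S with
  | zero =>
    rw [Finset.card_eq_zero] at hn
    subst hn
    exact ⟨0, I.zero_mem, by simp⟩
  | succ n ih =>
    have hne : S.Nonempty := by rw [← Finset.card_pos]; omega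
    obtain ⟨P, hP⟩ := S.exists_minimal hne
    have hPS : P ∈ S := hP.1
    obtain ⟨c, hcI, hc⟩ := ih (S.erase P) (fun Q hQ => hS Q (Finset.mem_of_mem_erase hQ))
      (fun Q hQ => h Q (Finset.mem_of_mem_erase hQ)) (by rw [Finset.card_erase_of_mem hPS]; omega)
    by_cases hxP : x + c ∈ P
    · have hIP : ¬ I ≤ P := fun hle => h P hPS ⟨by
        have := P.sub_mem hxP (hle hcI); simpa using this, hle⟩
      have hPp := hS P hPS
      have hprod : ¬ (I * ∏ Q ∈ S.erase P, Q) ≤ P := by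
        intro hle
        rcases (Ideal.IsPrime.mul_le hPp).1 hle with h1 | h1
        · exact hIP h1
        · obtain ⟨Q, hQ, hQP⟩ := (Ideal.IsPrime.prod_le hPp).1 h1
          have hQS := Finset.mem_of_mem_erase hQ
          have hPQ : P ≤ Q := hP.2 hQS hQP
          have hQP' : Q = P := le_antisymm hQP hPQ
          exact (Finset.ne_of_mem_erase hQ) hQP'
      obtain ⟨d, hd, hdP⟩ := SetLike.not_le_iff_exists.1 hprod
      have hdm : d ∈ I ⊓ ∏ Q ∈ S.erase P, Q := by
        generalize (∏ Q ∈ S.erase P, Q) = J at hd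
        exact (Ideal.mul_le_inf : I * J ≤ I ⊓ J) hd
      rw [Submodule.mem_inf] at hdm
      obtain ⟨hdI, hdJ⟩ := hdm
      refine ⟨c + d, I.add_mem hcI hdI, fun Q hQ hmem => ?_⟩
      rw [← add_assoc] at hmem
      by_cases hQP : Q = P
      · subst hQP
        exact hdP (by simpa using Q.sub_mem hmem hxP)
      · have hQe : Q ∈ S.erase P := Finset.mem_erase.2 ⟨hQP, hQ⟩
        have hdQ : d ∈ Q := by
          have h1 : (∏ Q ∈ S.erase P, Q) ≤ Q := Ideal.prod_le_inf.trans (Finset.inf_le hQe)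
          exact h1 hdJ
        exact hc Q hQe (by simpa using Q.sub_mem hmem hdQ)
    · refine ⟨c, hcI, fun Q hQ => ?_⟩
      by_cases hQP : Q = P
      · subst hQP; exact hxP
      · exact hc Q (Finset.mem_erase.2 ⟨hQP, hQ⟩)

/-- vanishing passes to the quotient -/
theorem ext_quot {X M : ModuleCat.{u} R} {y : R} (hy : IsSMulRegular M y) (n : ℕ)
    (h : ∀ i < n + 1, Subsingleton (Abelian.Ext X M i)) :
    ∀ i < n, Subsingleton (Abelian.Ext X (ModuleCat.of R (QuotSMulTop y M)) i) := by
  intro i hi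
  have zero1 := AddCommGrpCat.isZero_of_iff_subsingleton.mpr (h i (by omega))
  have zero2 := AddCommGrpCat.isZero_of_iff_subsingleton.mpr (h (i + 1) (by omega))
  exact AddCommGrpCat.subsingleton_of_isZero <| ShortComplex.Exact.isZero_of_both_zeros
    ((Abelian.Ext.covariant_sequence_exact₃' X hy.smulShortComplex_shortExact) i (i + 1) rfl)
    (zero1.eq_zero_of_src _) (zero2.eq_zero_of_tgt _)

theorem hom_subsing {a : Ideal R} {M : ModuleCat.{u} R}
    (h : Subsingleton (Abelian.Ext (ModuleCat.of R (R ⧸ a)) M 0)) (m : M)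
    (hm : ∀ r ∈ a, r • m = 0) : m = 0 := by
  have : Subsingleton (ModuleCat.of R (R ⧸ a) ⟶ M) :=
    Abelian.Ext.addEquiv₀.subsingleton_congr.mp h
  have : Subsingleton ((R ⧸ a) →ₗ[R] M) :=
    (ModuleCat.homAddEquiv (M := ModuleCat.of R (R ⧸ a)) (N := M)).symm.subsingleton
  let f : (R ⧸ a) →ₗ[R] M := a.liftQ (LinearMap.toSpanSingleton R M m) (by
    intro r hr; exact hm r hr)
  have hf : f (Submodule.Quotient.mk 1) = 0 := by
    rw [Subsingleton.elim f 0]; rfl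
  exact (one_smul R m).symm.trans hf

theorem not_le_assoc [IsNoetherianRing R] {a : Ideal R} {M : ModuleCat.{u} R}
    (h : Subsingleton (Abelian.Ext (ModuleCat.of R (R ⧸ a)) M 0)) (P : Ideal R)
    (hP : P ∈ associatedPrimes R M) : ¬ a ≤ P := by
  intro hle
  rw [AssociatedPrimes.mem_iff, isAssociatedPrime_iff] at hP
  obtain ⟨hp, m, hm⟩ := hP
  have : m = 0 := hom_subsing h m (fun r hr => by
    have := hle hr
    rw [hm, Submodule.mem_colon_singleton] at this
    exact this)
  apply hp.ne_top
  rw [hm, this]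
  simp

theorem exists_regular [IsNoetherianRing R] (a : Ideal R) (xs : List R) (b : Ideal R)
    (M N : ModuleCat.{u} R) [Module.Finite R M] [Module.Finite R N]
    (hab : a = Ideal.ofList xs ⊔ b) (hbM : b ≤ Module.annihilator R M)
    (hbN : b ≤ Module.annihilator R N)
    (hM : ∀ i < xs.length, Subsingleton (Abelian.Ext (ModuleCat.of R (R ⧸ a)) M i))
    (hN : ∀ i < xs.length, Subsingleton (Abelian.Ext (ModuleCat.of R (R ⧸ a)) N i)) :
    ∃ rs : List R, rs.length = xs.length ∧ Ideal.ofList rs = Ideal.ofList xs ∧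
      IsWeaklyRegular M rs ∧ IsWeaklyRegular N rs := by
  classical
  induction xs generalizing b M N with
  | nil => exact ⟨[], rfl, rfl, IsWeaklyRegular.nil _ _, IsWeaklyRegular.nil _ _⟩
  | cons x xs ih =>
    have key : ∀ (L : ModuleCat.{u} R) , b ≤ Module.annihilator R L →
        (∀ i < (x :: xs).length, Subsingleton (Abelian.Ext (ModuleCat.of R (R ⧸ a)) L i)) →
        ∀ P ∈ associatedPrimes R L, ¬ (x ∈ P ∧ Ideal.ofList xs ≤ P) := by
      rintro L hb hL P hP ⟨h1, h2⟩
      refine not_le_assoc (hL 0 (by simp)) P hP ?_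
      rw [hab, Ideal.ofList_cons]
      refine sup_le (sup_le ?_ h2) (hb.trans ?_)
      · rwa [Ideal.span_singleton_le_iff_mem]
      · rw [← Submodule.annihilator_top]
        exact IsAssociatedPrime.annihilator_le hP
    have fM := associatedPrimes.finite R M
    have fN := associatedPrimes.finite R N
    obtain ⟨c, hc, hy⟩ := coset_avoid (fM.toFinset ∪ fN.toFinset) (by
        intro P hP
        simp only [Finset.mem_union, Set.Finite.mem_toFinset] at hP
        rcases hP with hP | hP <;> exact hP.isPrime) x (Ideal.ofList xs) (by
        intro P hP
        simp only [Finset.mem_union, Set.Finite.mem_toFinset] at hP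
        rcases hP with hP | hP
        · exact key M hbM hM P hP
        · exact key N hbN hN P hP)
    set y := x + c with hydef
    have reg : ∀ (L : ModuleCat.{u} R), (∀ P ∈ associatedPrimes R L, y ∉ P) →
        IsSMulRegular L y := by
      intro L hL
      rw [isSMulRegular_iff_right_eq_zero_of_smul]
      intro m hm
      by_contra hne
      have : y ∈ ⋃ p ∈ associatedPrimes R L, (p : Set R) := by
        rw [biUnion_associatedPrimes_eq_zero_divisors]
        exact ⟨m, hne, hm⟩
      simp only [Set.mem_iUnion] at this
      obtain ⟨P, hP, hyP⟩ := this
      exact hL P hP hyP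
    have regM := reg M (fun P hP => hy P (by simp [hP]))
    have regN := reg N (fun P hP => hy P (by simp [hP]))
    have ann : ∀ (L : ModuleCat.{u} R), b ≤ Module.annihilator R L →
        b ⊔ Ideal.span {y} ≤ Module.annihilator R (QuotSMulTop y L) := by
      intro L hL
      refine sup_le ?_ ?_
      · exact hL.trans (LinearMap.annihilator_le_of_surjective (Submodule.mkQ _)
          (Submodule.mkQ_surjective _))
      · rw [Ideal.span_singleton_le_iff_mem, Module.mem_annihilator]
        intro m
        obtain ⟨m, rfl⟩ := Submodule.mkQ_surjective _ m
        rw [← map_smul]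
        simp only [Submodule.mkQ_apply, Submodule.Quotient.mk_eq_zero]
        exact Submodule.smul_mem_pointwise_smul _ _ _ trivial
    have hspan : Ideal.span {y} ⊔ Ideal.ofList xs = Ideal.span {x} ⊔ Ideal.ofList xs := by
      apply le_antisymm
      · refine sup_le ?_ le_sup_right
        rw [Ideal.span_singleton_le_iff_mem]
        exact add_mem (Ideal.mem_sup_left (Ideal.mem_span_singleton_self x))
          (Ideal.mem_sup_right hc)
      · refine sup_le ?_ le_sup_right
        rw [Ideal.span_singleton_le_iff_mem]
        have : x = y - c := by simp [hydef]
        rw [this]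
        exact sub_mem (Ideal.mem_sup_left (Ideal.mem_span_singleton_self y))
          (Ideal.mem_sup_right hc)
    obtain ⟨rs, h1, h2, h3, h4⟩ := ih (b ⊔ Ideal.span {y})
      (ModuleCat.of R (QuotSMulTop y M)) (ModuleCat.of R (QuotSMulTop y N)) (by
        rw [hab, Ideal.ofList_cons, ← hspan, sup_comm b, ← sup_assoc, sup_comm (Ideal.ofList xs)])
      (ann M hbM) (ann N hbN) (ext_quot regM _ hM) (ext_quot regN _ hN)
    exact ⟨y :: rs, by simp [h1], by rw [Ideal.ofList_cons, Ideal.ofList_cons, h2, hspan],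
      IsWeaklyRegular.cons regM h3, IsWeaklyRegular.cons regN h4⟩

/-- nonvanishing -/
theorem quot_eq_zero (X : ModuleCat.{u} R) (rs : List R) (M : ModuleCat.{u} R)
    (hreg : IsWeaklyRegular M rs)
    (h : ∀ i < rs.length + 1, Subsingleton (Abelian.Ext X M i)) :
    Subsingleton (Abelian.Ext X
      (ModuleCat.of R (M ⧸ Ideal.ofList rs • (⊤ : Submodule R M))) 0) := by
  induction rs generalizing M with
  | nil =>
    have e : (M ⧸ Ideal.ofList ([] : List R) • (⊤ : Submodule R M)) ≃ₗ[R] M :=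
      Submodule.quotEquivOfEqBot _ (by simp)
    have := h 0 (by simp)
    have e1 : (X ⟶ ModuleCat.of R (M ⧸ Ideal.ofList ([] : List R) • (⊤ : Submodule R M))) ≃
      (X ⟶ M) := (e.toModuleIso (X₂ := M)).homToEquiv
    exact (Abelian.Ext.addEquiv₀.toEquiv.trans (e1.trans
      Abelian.Ext.addEquiv₀.symm.toEquiv)).subsingleton
  | cons x rs ih =>
    rw [isWeaklyRegular_cons_iff] at hreg
    have := ih (ModuleCat.of R (QuotSMulTop x M)) hreg.2 (ext_quot hreg.1 _ h)
    have e := Submodule.quotOfListConsSMulTopEquivQuotSMulTopInner M x rs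
    have e1 := Iso.homToEquiv (Z := X) (e.toModuleIso)
    exact (Abelian.Ext.addEquiv₀.toEquiv.trans (e1.trans
      Abelian.Ext.addEquiv₀.symm.toEquiv)).subsingleton

theorem not_all_zero (a : Ideal R) (rs : List R) (M : ModuleCat.{u} R)
    (hreg : IsWeaklyRegular M rs) (ha : Ideal.ofList rs = a) (hne : a • (⊤ : Submodule R M) ≠ ⊤)
    (h : ∀ i < rs.length + 1, Subsingleton (Abelian.Ext (ModuleCat.of R (R ⧸ a)) M i)) :
    False := by
  have := quot_eq_zero _ rs M hreg h
  rw [ha] at this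
  apply hne
  rw [eq_top_iff]
  intro m _
  rw [← Submodule.Quotient.mk_eq_zero]
  refine hom_subsing this _ (fun r hr => ?_)
  rw [← Submodule.Quotient.mk_smul, Submodule.Quotient.mk_eq_zero]
  exact Submodule.smul_mem_smul hr trivial



open Limits CategoryTheory.ProjectiveResolution CochainComplex HomComplex in
theorem extMk_zero_iff0 {X Y : ModuleCat.{u} R} (P : ProjectiveResolution X)
    (f : P.complex.X 0 ⟶ Y) (hf : P.complex.d 1 0 ≫ f = 0) :
    P.extMk f 1 rfl hf = 0 ↔ f = 0 := by
  constructor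
  · intro h
    rw [← P.extEquivCohomologyClass.apply_eq_iff_eq,
      extEquivCohomologyClass_extMk, extEquivCohomologyClass_zero,
      CohomologyClass.mk_eq_zero_iff,
      Cocycle.toSingleMk_mem_coboundaries_iff _ _ _ _ _ 1 (by simp)] at h
    obtain ⟨g, hg⟩ := h
    have hz : IsZero (P.cochainComplex.X 1) := CochainComplex.isZero_of_isStrictlyLE _ 0 1 (by simp)
    rw [hz.eq_of_src g 0, comp_zero] at hg
    rw [← cancel_epi (P.cochainComplexXIso (-(0:ℕ)) 0 rfl).hom, ← hg, comp_zero]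
  · rintro rfl
    simp

theorem extMk_zero_iff {X Y : ModuleCat.{u} R} (P : ProjectiveResolution X) (n : ℕ)
    (f : P.complex.X n ⟶ Y) (hf : P.complex.d (n+1) n ≫ f = 0) :
    P.extMk f (n+1) rfl hf = 0 ↔
      ∃ g : P.complex.X ((ComplexShape.down ℕ).next n) ⟶ Y, P.complex.d n _ ≫ g = f := by
  cases n with
  | zero =>
    rw [extMk_zero_iff0]
    have : P.complex.d 0 ((ComplexShape.down ℕ).next 0) = 0 := by
      apply HomologicalComplex.shape; simp
    rw [this]
    simp [eq_comm]
  | succ n =>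
    rw [P.extMk_eq_zero_iff _ _ _ hf n rfl]
    have : (ComplexShape.down ℕ).next (n+1) = n := by simp
    rw [this]

noncomputable abbrev oldExt (n : ℕ) (X Y : ModuleCat.{u} R) : ModuleCat.{u} R :=
  ((Ext R (ModuleCat.{u} R) n).obj (op X)).obj Y

theorem subsingleton_oldExt_iff (n : ℕ) (X Y : ModuleCat.{u} R) :
    Subsingleton (oldExt n X Y) ↔ Subsingleton (Abelian.Ext X Y n) := by
  let P := projectiveResolution X
  rw [(P.isoExt (R := R) n Y).toLinearEquiv.toEquiv.subsingleton_congr,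
    ← ModuleCat.isZero_iff_subsingleton,
    ← HomologicalComplex.exactAt_iff_isZero_homology, HomologicalComplex.exactAt_iff,
    ShortComplex.moduleCat_exact_iff]
  constructor
  · intro h
    refine ⟨fun x y => ?_⟩
    suffices ∀ x : Abelian.Ext X Y n, x = 0 by rw [this x, this y]
    intro x
    obtain ⟨f, hf, rfl⟩ := P.extMk_surjective x (n+1) rfl
    rw [extMk_zero_iff]
    obtain ⟨g, hg⟩ := h f (by
      change P.complex.d ((ComplexShape.up ℕ).next n) n ≫ f = 0
      have : (ComplexShape.up ℕ).next n = n + 1 := by simp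
      rw [this]
      exact hf)
    exact ⟨g, hg⟩
  · intro h f hf
    have hf' : P.complex.d (n+1) n ≫ f = 0 := by
      change P.complex.d ((ComplexShape.up ℕ).next n) n ≫ f = 0 at hf
      have : (ComplexShape.up ℕ).next n = n + 1 := by simp
      rw [this] at hf
      exact hf
    have := (extMk_zero_iff P n f hf').1 (Subsingleton.elim _ _)
    obtain ⟨g, hg⟩ := this
    exact ⟨g, hg⟩

theorem homologyPi_zero_iff {ι : Type} {c : ComplexShape ι} (K : HomologicalComplex (ModuleCat.{u} R) c)
    (n : ι) (z : K.cycles n) :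
    (K.homologyπ n).hom z = 0 ↔ ∃ y, (K.sc n).f y = K.iCycles n z := by
  have hinj : Function.Injective (K.homologyι n) :=
    (ModuleCat.mono_iff_injective _).1 inferInstance
  have h1 : K.homologyι n (K.homologyπ n z) = K.pOpcycles n (K.iCycles n z) := by
    have := K.homology_π_ι n
    exact congrArg (fun t => t.hom z) this
  have h2 := (K.sc n).moduleCat_pOpcycles_eq_zero_iff (K.iCycles n z)
  constructor
  · intro h
    have h3 : K.pOpcycles n (K.iCycles n z) = 0 := by
      rw [← h1]
      change K.homologyι n ((K.homologyπ n).hom z) = 0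
      rw [h, map_zero]
    obtain ⟨y, hy⟩ := h2.1 h3
    exact ⟨y, hy⟩
  · rintro ⟨y, hy⟩
    apply hinj
    rw [map_zero]
    exact h1.trans (h2.2 ⟨y, hy⟩)

theorem epi_aux {C : Type*} [Category C] {A B A' B' : C} (f : A ⟶ B) (i : B ≅ B') (j : A ≅ A')
    (m : A' ⟶ B') (hm : Epi m) (h : f ≫ i.hom = j.hom ≫ m) : Epi f := by
  rw [← Iso.eq_comp_inv] at h
  rw [h]
  infer_instance

theorem oldExt_map_injective (n : ℕ) {X X' : ModuleCat.{u} R} (Y : ModuleCat.{u} R) (f : X ⟶ X')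
    (h : ∀ x : Abelian.Ext X' Y n, (Abelian.Ext.mk₀ f).comp x (zero_add n) = 0 → x = 0) :
    Function.Injective ((((Ext R (ModuleCat.{u} R) n).map f.op).app Y).hom) := by
  let P := projectiveResolution X
  let P' := projectiveResolution X'
  let φ : P.Hom P' f := ⟨ProjectiveResolution.lift f P P', by
    have := ProjectiveResolution.lift_commutes_zero f P P'
    simpa using this⟩
  have hφ : φ.hom.f 0 ≫ P'.π.f 0 = P.π.f 0 ≫ f := φ.hom_f_zero_comp_π_f_zero
  let F := ((linearYoneda R (ModuleCat.{u} R)).obj Y).rightOp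
  let ψ : P'.complex.linearYonedaObj R Y ⟶ P.complex.linearYonedaObj R Y :=
    (HomologicalComplex.unopFunctor _ _).map ((F.mapHomologicalComplex _).map φ.hom).op
  have hmono : Mono (HomologicalComplex.homologyMap ψ n) := by
    rw [ModuleCat.mono_iff_injective, injective_iff_map_eq_zero]
    intro x hx
    obtain ⟨c, rfl⟩ := (ModuleCat.epi_iff_surjective
      (HomologicalComplex.homologyπ (P'.complex.linearYonedaObj R Y) n)).1 inferInstance x
    have hc : P'.complex.d ((ComplexShape.up ℕ).next n) n ≫
        ((P'.complex.linearYonedaObj R Y).iCycles n).hom c = 0 := by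
      have := (P'.complex.linearYonedaObj R Y).iCycles_d n ((ComplexShape.up ℕ).next n)
      exact congrArg (fun t => t.hom c) this
    have hnext : (ComplexShape.up ℕ).next n = n + 1 := by simp
    rw [hnext] at hc
    obtain ⟨z, hz0⟩ : ∃ z : P'.complex.X n ⟶ Y, z =
      ((P'.complex.linearYonedaObj R Y).iCycles n).hom c := ⟨_, rfl⟩
    have hc' : P'.complex.d (n+1) n ≫ z = 0 := by rw [hz0]; exact hc
    have hx' : (HomologicalComplex.homologyπ (P.complex.linearYonedaObj R Y) n).hom
        ((HomologicalComplex.cyclesMap ψ n).hom c) = 0 := by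
      have := HomologicalComplex.homologyπ_naturality ψ n
      have := congrArg (fun t => t.hom c) this
      exact this.symm.trans hx
    rw [homologyPi_zero_iff] at hx'
    refine (homologyPi_zero_iff _ _ _).2 ?_
    obtain ⟨y, hy⟩ := hx'
    have hy2 : ((P.complex.linearYonedaObj R Y).iCycles n)
        ((HomologicalComplex.cyclesMap ψ n).hom c) =
        φ.hom.f n ≫ ((P'.complex.linearYonedaObj R Y).iCycles n).hom c := by
      have := HomologicalComplex.cyclesMap_i ψ n
      exact congrArg (fun t => t.hom c) this
    rw [hy2] at hy
    have hz := h (P'.extMk z (n+1) rfl hc') ((P'.mk₀_comp_extMk z (n+1) rfl hc' φ).trans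
      ((extMk_zero_iff P n _ _).2 ⟨y, by rw [hz0]; exact hy⟩))
    obtain ⟨g, hg⟩ := (extMk_zero_iff P' n z hc').1 hz
    exact ⟨g, hg.trans hz0⟩
  have nat := ProjectiveResolution.isoLeftDerivedObj_hom_naturality f P P' φ.hom hφ F n
  have nat2 := HomologicalComplex.homologyOp_hom_naturality ψ n
  have hepi : Epi (HomologicalComplex.homologyMap ((F.mapHomologicalComplex _).map φ.hom) n) := by
    have e : Epi (HomologicalComplex.homologyMap ((HomologicalComplex.opFunctor _ _).map ψ.op) n) := by
      have hm : Epi (HomologicalComplex.homologyMap ψ n).op := inferInstance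
      exact epi_aux _ (HomologicalComplex.homologyOp (P'.complex.linearYonedaObj R Y) n)
        (HomologicalComplex.homologyOp (P.complex.linearYonedaObj R Y) n) _ hm nat2
    exact e
  have hepi2 : Epi ((F.leftDerived n).map f) := by
    rw [← Iso.eq_comp_inv] at nat
    rw [nat]
    have : Epi ((F.mapHomologicalComplex (ComplexShape.down ℕ) ⋙
      HomologicalComplex.homologyFunctor _ _ n).map φ.hom) := hepi
    infer_instance
  have : Mono (((F.leftDerived n).map f).unop) := inferInstance
  exact (ModuleCat.mono_iff_injective _).1 this


theorem powers_regular [IsNoetherianRing R] (k : ℕ) (bs as : List R)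
    (hJ : ∀ r ∈ as ++ bs, r ∈ (⊥ : Ideal R).jacobson) (h : IsWeaklyRegular R (as ++ bs)) :
    IsWeaklyRegular R (as ++ bs.map (· ^ (k+1))) := by
  have hann : Module.annihilator R R = ⊥ := by
    rw [Module.annihilator_eq_bot]; infer_instance
  induction bs generalizing as with
  | nil => simpa using h
  | cons b bs ih =>
    have h1 : IsWeaklyRegular R ((as ++ bs) ++ [b]) := by
      refine IsWeaklyRegular.of_perm_of_subset_jacobson_annihilator h ?_ (by rw [hann]; exact hJ)
      rw [List.append_assoc]
      exact List.Perm.append_left _ (List.perm_append_singleton b bs).symm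
    have h2 : IsWeaklyRegular R ((as ++ bs) ++ [b ^ (k+1)]) := by
      rw [isWeaklyRegular_append_iff] at h1 ⊢
      refine ⟨h1.1, ?_⟩
      have := h1.2
      rw [isWeaklyRegular_singleton_iff] at this ⊢
      exact this.pow _
    have hJ2 : ∀ r ∈ (as ++ bs) ++ [b ^ (k+1)], r ∈ (⊥ : Ideal R).jacobson := by
      intro r hr
      simp only [List.mem_append, List.mem_singleton] at hr
      rcases hr with hr | rfl
      · apply hJ; simp; tauto
      · exact Ideal.pow_mem_of_mem _ (hJ b (by simp)) _ (by omega)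
    have p : ((as ++ bs) ++ [b ^ (k+1)]).Perm ((b^(k+1) :: as) ++ bs) :=
      List.perm_append_singleton _ _
    have h3 := IsWeaklyRegular.of_perm_of_subset_jacobson_annihilator h2 p (by rw [hann]; exact hJ2)
    have hJ3 : ∀ r ∈ (b^(k+1) :: as) ++ bs, r ∈ (⊥ : Ideal R).jacobson := fun r hr =>
      hJ2 r (p.mem_iff.2 hr)
    have h4 := ih (b^(k+1) :: as) hJ3 h3
    refine IsWeaklyRegular.of_perm_of_subset_jacobson_annihilator h4 ?_ ?_
    · rw [List.map_cons, List.cons_append]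
      exact List.perm_middle.symm
    · rw [hann]
      intro r hr
      simp only [List.cons_append, List.mem_cons, List.mem_append, List.mem_map] at hr
      rcases hr with hr | hr | ⟨c, hc, rfl⟩
      · exact hJ3 r (by simp [hr])
      · exact hJ3 r (by simp [hr])
      · exact Ideal.pow_mem_of_mem _ (hJ c (by simp [hc])) _ (by omega)

theorem pd_quot (rs : List R) (d : ℕ) (M : ModuleCat.{u} R) (hM : HasProjectiveDimensionLT M (d+1))
    (h : IsWeaklyRegular M rs) :
    HasProjectiveDimensionLT (ModuleCat.of R (M ⧸ (Ideal.ofList rs • (⊤ : Submodule R M))))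
      (d + 1 + rs.length) := by
  induction rs generalizing d M with
  | nil =>
    have e : M ≃ₗ[R] (M ⧸ (Ideal.ofList ([] : List R) • (⊤ : Submodule R M))) :=
      (Submodule.quotEquivOfEqBot _ (by simp)).symm
    exact hasProjectiveDimensionLT_of_iso (X := M) (X' := ModuleCat.of R _) e.toModuleIso (d + 1)
  | cons r rs ih =>
    rw [isWeaklyRegular_cons_iff] at h
    have h3 : HasProjectiveDimensionLT (ModuleCat.of R (QuotSMulTop r M)) (d + 1 + 1) :=
      h.1.smulShortComplex_shortExact.hasProjectiveDimensionLT_X₃ (d+1) hM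
        (hasProjectiveDimensionLT_of_ge M (d+1) (d+2) (by omega))
    have h4 := ih (d+1) (ModuleCat.of R (QuotSMulTop r M)) h3 h.2
    have e := (Submodule.quotOfListConsSMulTopEquivQuotSMulTopInner M r rs).symm
    have := hasProjectiveDimensionLT_of_iso (X := ModuleCat.of R _) (X' := ModuleCat.of R _) e.toModuleIso (d + 1 + 1 + rs.length)
    convert this using 1
    simp; omega

theorem pd_ring (rs : List R) (h : IsWeaklyRegular R rs) :
    HasProjectiveDimensionLT (ModuleCat.of R (R ⧸ Ideal.ofList rs)) (1 + rs.length) := by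
  have h0 : HasProjectiveDimensionLT (ModuleCat.of R R) (0+1) := by
    have : Projective (ModuleCat.of R R) := inferInstance
    infer_instance
  have := pd_quot rs 0 (ModuleCat.of R R) h0 h
  have e : (R ⧸ (Ideal.ofList rs • (⊤ : Submodule R R))) ≃ₗ[R] (R ⧸ Ideal.ofList rs) :=
    Submodule.quotEquivOfEq _ _ (by simp)
  rw [zero_add] at this
  exact hasProjectiveDimensionLT_of_iso (X := ModuleCat.of R _) (X' := ModuleCat.of R _) e.toModuleIso (1 + rs.length)

theorem ofList_pow_le (rs : List R) (k : ℕ) :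
    Ideal.ofList (rs.map (· ^ (k+1))) ≤ (Ideal.ofList rs) ^ k := by
  rw [Ideal.ofList, Ideal.span_le]
  rintro x hx
  obtain ⟨r, hr, rfl⟩ := List.mem_map.1 hx
  exact Ideal.pow_le_pow_right (Nat.le_succ k) (Ideal.pow_mem_pow (show r ∈ Ideal.ofList rs from Ideal.subset_span hr) _)

theorem exists_pow_le_ofList [IsNoetherianRing R] (rs : List R) (k : ℕ) :
    ∃ m, (Ideal.ofList rs) ^ m ≤ Ideal.ofList (rs.map (· ^ (k+1))) := by
  apply Ideal.exists_pow_le_of_le_radical_of_fg _ (IsNoetherian.noetherian _)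
  conv_lhs => rw [Ideal.ofList]
  rw [Ideal.span_le]
  intro r hr
  exact ⟨k+1, Ideal.subset_span (List.mem_map.2 ⟨r, hr, rfl⟩)⟩

open Limits in
theorem colim_subsingleton {J : Type} [SmallCategory J] (G : J ⥤ ModuleCat.{u} R) (c : Cocone G)
    (hc : IsColimit c) (h : ∀ j, ∃ (j' : J) (f : j ⟶ j'), G.map f = 0) : Subsingleton c.pt := by
  rw [← ModuleCat.isZero_iff_subsingleton, IsZero.iff_id_eq_zero]
  refine hc.hom_ext fun j => ?_
  obtain ⟨j', f, hf⟩ := h j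
  rw [← c.w f, hf]
  simp

open Limits in
theorem colim_nontrivial {J : Type} [SmallCategory J] [IsFiltered J] (G : J ⥤ ModuleCat.{u} R)
    (c : Cocone G) (hc : IsColimit c) (j : J) (hj : Nontrivial (G.obj j))
    (h : ∀ (j' : J) (f : j ⟶ j'), Function.Injective (G.map f).hom) : Nontrivial c.pt := by
  have := preservesSmallestFilteredColimits_of_preservesFilteredColimits (forget (ModuleCat.{u} R))
  obtain ⟨x, hx⟩ := exists_ne (0 : G.obj j)
  refine ⟨(c.ι.app j).hom x, 0, fun h0 => hx ?_⟩
  obtain ⟨k, f, g, hfg⟩ := Concrete.isColimit_exists_of_rep_eq G hc (i := j) (j := j) x 0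
    (h0.trans (map_zero (c.ι.app j).hom).symm)
  apply h k f
  exact hfg.trans ((map_zero (G.map g).hom).trans (map_zero (G.map f).hom).symm)

/-- transition maps -/
noncomputable def trans {I J : Ideal R} (h : I ≤ J) :
    ModuleCat.of R (R ⧸ I) ⟶ ModuleCat.of R (R ⧸ J) :=
  ModuleCat.ofHom <| Submodule.mapQ I J LinearMap.id h

theorem trans_comp {I J K : Ideal R} (h : I ≤ J) (h' : J ≤ K) :
    trans h ≫ trans h' = trans (h.trans h') := by
  ext; rfl

theorem localCoh_subsingleton (a : Ideal R) (i : ℕ) (Y : ModuleCat.{u} R)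
    (h : ∀ k, ∃ m, ∃ hkm : k ≤ m, ((Ext R (ModuleCat.{u} R) i).map (trans (Ideal.pow_le_pow_right (I := a) hkm)).op).app Y = 0) :
    Subsingleton ((localCohomology a i).obj Y) := by
  have := localCohomology.hasColimitDiagram.{u, 0} (localCohomology.idealPowersDiagram a) i
  refine colim_subsingleton (localCohomology.diagram (localCohomology.idealPowersDiagram a) i ⋙ (evaluation _ _).obj Y)
    (((evaluation _ _).obj Y).mapCocone (Limits.colimit.cocone _)) (Limits.isColimitOfPreserves _ (Limits.colimit.isColimit _)) ?_
  intro j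
  obtain ⟨m, hkm, h0⟩ := h j.unop.unop
  exact ⟨op (op m), (homOfLE hkm).op.op, h0⟩

theorem localCoh_nontrivial (a : Ideal R) (i : ℕ) (Y : ModuleCat.{u} R) (k : ℕ)
    (hk : Nontrivial (oldExt i (ModuleCat.of R (R ⧸ a ^ k)) Y))
    (h : ∀ m (hkm : k ≤ m), Function.Injective (((Ext R (ModuleCat.{u} R) i).map
      (trans (Ideal.pow_le_pow_right (I := a) hkm)).op).app Y).hom) :
    Nontrivial ((localCohomology a i).obj Y) := by
  have := localCohomology.hasColimitDiagram.{u, 0} (localCohomology.idealPowersDiagram a) i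
  refine colim_nontrivial (localCohomology.diagram (localCohomology.idealPowersDiagram a) i ⋙ (evaluation _ _).obj Y)
    (((evaluation _ _).obj Y).mapCocone (Limits.colimit.cocone _)) (Limits.isColimitOfPreserves _ (Limits.colimit.isColimit _))
    (op (op k)) hk ?_
  intro j' f
  exact h j'.unop.unop f.unop.unop.down.down

theorem oldExt_map_zero (i : ℕ) {X Z X' : ModuleCat.{u} R} (Y : ModuleCat.{u} R) (f : X ⟶ Z) (g : Z ⟶ X')
    (h : Subsingleton (oldExt i Z Y)) : ((Ext R (ModuleCat.{u} R) i).map (f ≫ g).op).app Y = 0 := by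
  have hz : Limits.IsZero (oldExt i Z Y) := ModuleCat.isZero_iff_subsingleton.2 h
  rw [op_comp, Functor.map_comp, NatTrans.comp_app]
  rw [hz.eq_of_src (((Ext R (ModuleCat.{u} R) i).map f.op).app Y) 0, Limits.comp_zero]

theorem support_le (a : Ideal R) (m : ℕ) (K : Submodule R (R ⧸ a ^ m)) :
    Module.support R K ⊆ PrimeSpectrum.zeroLocus a := by
  refine (Module.support_subset_of_injective K.subtype K.injective_subtype).trans ?_
  rw [Module.support_eq_zeroLocus, Ideal.annihilator_quotient]
  intro p hp x hx
  have hp' : a ^ m ≤ p.asIdeal := hp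
  exact p.2.mem_of_pow_mem m (hp' (Ideal.pow_mem_pow hx m))

theorem trans_injective [IsNoetherianRing R] (a : Ideal R) (rs : List R) (hreg : IsRegular R rs)
    (ha : Ideal.ofList rs = a) (m : ℕ) (hm : 1 ≤ m) (l : ℕ) (hn : rs.length = l) :
    Function.Injective (((Ext R (ModuleCat.{u} R) l).map
      (trans (Ideal.pow_le_pow_right (I := a) hm)).op).app (ModuleCat.of R R)).hom := by
  apply oldExt_map_injective
  intro x hx
  set f := trans (Ideal.pow_le_pow_right (I := a) hm) with hf
  have hsurj : Function.Surjective f.hom := by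
    intro y
    obtain ⟨y, rfl⟩ := Submodule.mkQ_surjective _ y
    exact ⟨Submodule.mkQ _ y, rfl⟩
  let S : ShortComplex (ModuleCat.{u} R) :=
    ShortComplex.mk (ModuleCat.ofHom (LinearMap.ker f.hom).subtype) f (by ext x; exact x.2)
  have hS : S.ShortExact := 
    { exact := by
        rw [ShortComplex.moduleCat_exact_iff]
        intro x hx
        exact ⟨⟨x, hx⟩, rfl⟩
      mono_f := (ModuleCat.mono_iff_injective _).2 (Submodule.injective_subtype _)
      epi_g := (ModuleCat.epi_iff_surjective _).2 hsurj }
  cases l with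
  | zero =>
    have : Epi f := hS.epi_g
    exact Abelian.Ext.precomp_mk₀_injective_of_epi (ModuleCat.of R R) f (hx.trans (by simp))
  | succ n =>
    obtain ⟨x₁, hx₁⟩ := Abelian.Ext.contravariant_sequence_exact₃ hS (ModuleCat.of R R) x hx
      (n₀ := n) (by omega)
    have hlt : a • (⊤ : Submodule R R) < ⊤ := by
      rw [lt_top_iff_ne_top, ← ha]
      exact hreg.2.symm
    have := ModuleCat.subsingleton_ext_of_exists_isRegular a
      (ModuleCat.of R (LinearMap.ker f.hom)) (support_le a m _) (ModuleCat.of R R) hlt rs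
      (fun r hr => ha ▸ Ideal.subset_span hr) hreg n (by omega)
    have h0 : x₁ = 0 := this.elim _ _
    rw [← hx₁, h0, Abelian.Ext.comp_zero]

theorem ext_lt [IsNoetherianRing R] (a : Ideal R) (rs : List R) (M : ModuleCat.{u} R) [Module.Finite R M]
    (hreg : IsRegular M rs) (ha : Ideal.ofList rs = a) (i : ℕ) (hi : i < rs.length) :
    Subsingleton (Abelian.Ext (ModuleCat.of R (R ⧸ a)) M i) := by
  have hlt : a • (⊤ : Submodule R M) < ⊤ := by
    rw [lt_top_iff_ne_top, ← ha]
    exact hreg.2.symm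
  exact ModuleCat.subsingleton_ext_of_exists_isRegular a
      (ModuleCat.of R (R ⧸ a)) (by
        change Module.support R (R ⧸ a) ⊆ _
        rw [Module.support_eq_zeroLocus, Ideal.annihilator_quotient]) M hlt rs
      (fun r hr => ha ▸ Ideal.subset_span hr) hreg i hi

theorem ext_ne [IsNoetherianRing R] (a : Ideal R) (rs : List R) (M : ModuleCat.{u} R) [Module.Finite R M]
    (hreg : IsRegular M rs) (ha : Ideal.ofList rs = a) :
    Nontrivial (oldExt rs.length (ModuleCat.of R (R ⧸ a)) M) := by
  by_contra hne
  rw [not_nontrivial_iff_subsingleton, subsingleton_oldExt_iff] at hne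
  refine not_all_zero a rs M hreg.1 ha (by rw [← ha]; exact hreg.2.symm) fun i hi => ?_
  rcases Nat.lt_succ_iff_lt_or_eq.1 hi with h | rfl
  · exact ext_lt a rs M hreg ha i h
  · exact hne

theorem rgrade_eq [IsNoetherianRing R] (a : Ideal R) (rs : List R) (M : Type u) [AddCommGroup M]
    [Module R M] [Module.Finite R M] (hreg : IsRegular M rs) (ha : Ideal.ofList rs = a) :
    rgrade R a M = rs.length := by
  have h1 : rs.length ∈ {i | Nontrivial (relExt R a i M)} := ext_ne a rs (ModuleCat.of R M) hreg ha
  apply le_antisymm (Nat.sInf_le h1)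
  refine le_csInf ⟨_, h1⟩ fun i hi => ?_
  by_contra hlt
  have h2 := (subsingleton_oldExt_iff i _ _).2 (ext_lt a rs (ModuleCat.of R M) hreg ha i (not_le.1 hlt))
  have hi' : Nontrivial (oldExt i (ModuleCat.of R (R ⧸ a)) (ModuleCat.of R M)) := hi
  exact not_subsingleton _ h2

theorem rcd_eq [IsNoetherianRing R] (a : Ideal R) (hJac : a ≤ (⊥ : Ideal R).jacobson) (rs : List R)
    (hreg : IsRegular R rs) (ha : Ideal.ofList rs = a) : rcd R a R = rs.length := by
  have hmem : rs.length ∈ {i | Nontrivial (localCoh R a i R)} := by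
    refine localCoh_nontrivial a rs.length (ModuleCat.of R R) 1 ?_ ?_
    · rw [pow_one]
      exact ext_ne a rs (ModuleCat.of R R) hreg ha
    · intro m hm
      exact trans_injective a rs hreg ha m hm _ rfl
  have hub : ∀ i ∈ {i | Nontrivial (localCoh R a i R)}, i ≤ rs.length := by
    intro i hi
    by_contra hlt
    have hi' : Nontrivial ((localCohomology a i).obj (ModuleCat.of R R)) := hi
    have : Subsingleton ((localCohomology a i).obj (ModuleCat.of R R)) := by
      apply localCoh_subsingleton
      intro k
      have hw := powers_regular k rs [] (by
        intro r hr
        exact hJac (ha ▸ Ideal.subset_span hr)) hreg.1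
      rw [List.nil_append] at hw
      obtain ⟨m, hm⟩ := exists_pow_le_ofList rs k
      have hpd := pd_ring _ hw
      have hs : Subsingleton (oldExt i (ModuleCat.of R (R ⧸ Ideal.ofList (rs.map (· ^ (k+1)))))
          (ModuleCat.of R R)) := by
        rw [subsingleton_oldExt_iff]
        exact HasProjectiveDimensionLT.subsingleton _ (1 + (rs.map (· ^ (k+1))).length) i (by rw [List.length_map]; omega) _
      have l1 : a ^ (max k m) ≤ Ideal.ofList (rs.map (· ^ (k+1))) :=
        (Ideal.pow_le_pow_right (le_max_right k m)).trans (ha ▸ hm)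
      have l2 : Ideal.ofList (rs.map (· ^ (k+1))) ≤ a ^ k := ha ▸ ofList_pow_le rs k
      refine ⟨max k m, le_max_left _ _, ?_⟩
      rw [← trans_comp l1 l2]
      exact oldExt_map_zero i _ _ _ hs
    exact not_subsingleton _ this
  exact le_antisymm (csSup_le ⟨_, hmem⟩ hub) (le_csSup ⟨_, hub⟩ hmem)

theorem mu_mem [IsNoetherianRing R] (a : Ideal R) :
    ∃ s : Finset R, s.card = mu R a ∧ Ideal.span (↑s : Set R) = a := by
  have : (mu R a) ∈ {n | ∃ s : Finset R, s.card = n ∧ Ideal.span (↑s : Set R) = a} := by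
    apply Nat.sInf_mem
    obtain ⟨s, hs⟩ := (IsNoetherian.noetherian a : a.FG)
    exact ⟨s.card, s, rfl, hs⟩
  exact this

theorem mu_list [IsNoetherianRing R] (a : Ideal R) :
    ∃ xs : List R, xs.length = mu R a ∧ Ideal.ofList xs = a := by
  obtain ⟨s, hs, h⟩ := mu_mem a
  refine ⟨s.toList, by simp [hs], ?_⟩
  rw [← h]
  simp [Ideal.ofList]

theorem mu_eq [IsNoetherianRing R] (a : Ideal R) (rs : List R)
    (hreg : IsRegular R rs) (ha : Ideal.ofList rs = a) : mu R a = rs.length := by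
  classical
  apply le_antisymm
  · have : mu R a ≤ rs.toFinset.card := Nat.sInf_le ⟨rs.toFinset, rfl, by
      rw [← ha]; simp [Ideal.ofList]⟩
    exact this.trans (List.toFinset_card_le rs)
  · by_contra hlt
    obtain ⟨xs, hxs, h⟩ := mu_list a
    have hv : ∀ i < rs.length, Subsingleton (Abelian.Ext (ModuleCat.of R (R ⧸ a)) (ModuleCat.of R R) i) :=
      ext_lt a rs (ModuleCat.of R R) hreg ha
    obtain ⟨ys, hl, he, hw, -⟩ := exists_regular a xs ⊥ (ModuleCat.of R R) (ModuleCat.of R R)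
      (by simp [h]) bot_le bot_le (fun i hi => hv i (by omega)) (fun i hi => hv i (by omega))
    refine not_all_zero a ys (ModuleCat.of R R) hw (he.trans h) ?_ (fun i hi => hv i (by omega))
    rw [← ha]
    exact hreg.2.symm

theorem ext_of_lt_rgrade (a : Ideal R) (M : Type u) [AddCommGroup M] [Module R M]
    (i : ℕ) (hi : i < rgrade R a M) :
    Subsingleton (Abelian.Ext (ModuleCat.of R (R ⧸ a)) (ModuleCat.of R M) i) := by
  rw [← subsingleton_oldExt_iff, ← not_nontrivial_iff_subsingleton]
  exact Nat.notMem_of_lt_sInf hi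

end RelReg

/-- for `a` in the Jacobson radical and `M` a nonzero finitely generated
module, `M` is `a`-relative regular iff `grade(a,M) = grade(a,R) = μ(a)`. -/
theorem stmt17 [IsNoetherianRing R] (a : Ideal R)
    (hJac : a ≤ (⊥ : Ideal R).jacobson)
    (M : Type u) [AddCommGroup M] [Module R M] [Module.Finite R M] [Nontrivial M] :
    IsRelRegularMod R a M ↔ (rgrade R a M = rgrade R a R ∧ rgrade R a R = mu R a) := by
  have hMne : (⊤ : Submodule R M) ≠ a • ⊤ :=
    Submodule.top_ne_ideal_smul_of_le_jacobson_annihilator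
      (hJac.trans (Ideal.jacobson_mono bot_le))
  have hRnt : Nontrivial R := Module.nontrivial R M
  have hRne : (⊤ : Submodule R R) ≠ a • ⊤ :=
    Submodule.top_ne_ideal_smul_of_le_jacobson_annihilator
      (hJac.trans (Ideal.jacobson_mono bot_le))
  constructor
  · rintro (h | ⟨-, rs, -, ha, hM, hR⟩)
    · exact absurd h.symm hMne
    · rw [RelReg.rgrade_eq a rs M hM ha, RelReg.rgrade_eq a rs R hR ha, RelReg.mu_eq a rs hR ha]
      exact ⟨rfl, rfl⟩
  · rintro ⟨h1, h2⟩
    obtain ⟨xs, hxs, h⟩ := RelReg.mu_list a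
    obtain ⟨rs, hl, he, hwM, hwR⟩ := RelReg.exists_regular a xs ⊥ (ModuleCat.of R M)
      (ModuleCat.of R R) (by simp [h]) bot_le bot_le
      (fun i hi => RelReg.ext_of_lt_rgrade a M i (by omega))
      (fun i hi => RelReg.ext_of_lt_rgrade a R i (by omega))
    have ha : Ideal.ofList rs = a := he.trans h
    have hM : RingTheory.Sequence.IsRegular M rs := ⟨hwM, by rw [ha]; exact hMne⟩
    have hR : RingTheory.Sequence.IsRegular R rs := ⟨hwR, by rw [ha]; exact hRne⟩
    exact Or.inr ⟨hMne.symm, rs, (RelReg.rcd_eq a hJac rs hR ha).symm, ha, hM, hR⟩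
end

section
/- Let 𝔞 be a proper ideal of R and M an 𝔞-relative regular R-module. Then Ext^i_R(R/𝔞, M) ≅ M/𝔞M for i = cd(𝔞,R) and Ext^i_R(R/𝔞, M) = 0 for i ≠ cd(𝔞,R); in particular M is 𝔞-relative Gorenstein. -/
open CategoryTheory Opposite
open scoped TensorProduct

universe u

variable (R : Type u) [CommRing R]

open Abelian in
lemma extMk_zero_iff' {X Y : ModuleCat.{u} R} (P : ProjectiveResolution X) (n : ℕ)
    (f : P.complex.X n ⟶ Y) (hf : P.complex.d (n+1) n ≫ f = 0) :
    P.extMk f (n+1) rfl hf = 0 ↔ ∃ g : P.complex.X (n-1) ⟶ Y, P.complex.d n (n-1) ≫ g = f := by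
  rcases n with _ | n
  · constructor
    · intro h
      refine ⟨0, ?_⟩
      rw [← P.extEquivCohomologyClass.apply_eq_iff_eq,
        P.extEquivCohomologyClass_extMk, P.extEquivCohomologyClass_zero,
        CochainComplex.HomComplex.CohomologyClass.mk_eq_zero_iff,
        CochainComplex.HomComplex.Cocycle.toSingleMk_mem_coboundaries_iff _ _ _ _ _ 1 (by simp)] at h
      obtain ⟨g, hg⟩ := h
      have hz : Limits.IsZero (P.cochainComplex.X 1) :=
        P.cochainComplex.isZero_of_isStrictlyLE 0 1 (by lia)
      rw [hz.eq_of_src g 0, Limits.comp_zero] at hg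
      rw [Limits.comp_zero, ← cancel_epi (P.cochainComplexXIso (-(0:ℕ)) 0 rfl).hom, ← hg,
        Limits.comp_zero]
    · rintro ⟨g, hg⟩
      have : f = 0 := by
        rw [← hg, P.complex.shape _ _ (by simp), Limits.zero_comp]
      subst this
      exact P.extMk_zero _ _
  · exact P.extMk_eq_zero_iff f _ rfl hf n rfl

lemma smul_extMk' {X Y : ModuleCat.{u} R} (P : ProjectiveResolution X) (n : ℕ) (r : R)
    (f : P.complex.X n ⟶ Y) (hf : P.complex.d (n+1) n ≫ f = 0)
    (hf' : P.complex.d (n+1) n ≫ (r • f) = 0) :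
    P.extMk (r • f) (n+1) rfl hf' = r • P.extMk f (n+1) rfl hf := by
  rw [Abelian.Ext.smul_eq_comp_mk₀, P.extMk_comp_mk₀]
  simp only [Linear.comp_smul, Category.comp_id]

noncomputable def extCyc {X Y : ModuleCat.{u} R} (P : ProjectiveResolution X) (n : ℕ) :
    LinearMap.ker ((P.complex.linearYonedaObj R Y).sc' (n-1) n (n+1)).g.hom →ₗ[R]
      Abelian.Ext X Y n where
  toFun f := P.extMk (f.1 : P.complex.X n ⟶ Y) (n+1) rfl f.2
  map_add' f g := (P.add_extMk _ _ _ _ _ _).symm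
  map_smul' r f := smul_extMk' R P n r f.1 f.2 (r • f).2

lemma ext_compare (X Y : ModuleCat.{u} R) (n : ℕ) :
    Nonempty (((Ext R (ModuleCat R) n).obj (op X)).obj Y ≃ₗ[R] Abelian.Ext X Y n) := by
  let P := ProjectiveResolution.of X
  let K := P.complex.linearYonedaObj R Y
  let S := K.sc' (n-1) n (n+1)
  let e1 : ((Ext R (ModuleCat R) n).obj (op X)).obj Y ≅ S.moduleCatLeftHomologyData.H :=
    P.isoExt n Y ≪≫ K.homologyIsoSc' (n-1) n (n+1) (by cases n <;> simp) (by simp) ≪≫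
      S.moduleCatHomologyIso
  have hsurj : Function.Surjective (extCyc R (Y := Y) P n) := fun α => by
    obtain ⟨f, hf, h⟩ := P.extMk_surjective α (n+1) rfl
    exact ⟨⟨f, hf⟩, h⟩
  have hk : LinearMap.range S.moduleCatToCycles = LinearMap.ker (extCyc R (Y := Y) P n) := by
    ext ⟨f, hf⟩
    refine Iff.trans ?_ (extMk_zero_iff' R P n f hf).symm
    constructor
    · rintro ⟨g, hg⟩
      exact ⟨g, congrArg Subtype.val hg⟩
    · rintro ⟨g, hg⟩
      exact ⟨g, Subtype.ext hg⟩
  exact ⟨e1.toLinearEquiv.trans ((Submodule.quotEquivOfEq _ _ hk).trans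
    (LinearMap.quotKerEquivOfSurjective _ hsurj))⟩


open Pointwise in
lemma ext_step (N M : ModuleCat.{u} R) (x : R) (k : ℕ) (hx : IsSMulRegular N x)
    (hE : IsSMulRegular (Abelian.Ext N M k) x)
    (h0 : ∀ i ≠ k, Subsingleton (Abelian.Ext N M i)) :
    Nonempty (Abelian.Ext (ModuleCat.of R (QuotSMulTop x N)) M (k+1) ≃ₗ[R]
      QuotSMulTop x (Abelian.Ext N M k)) ∧
    ∀ i ≠ k+1, Subsingleton (Abelian.Ext (ModuleCat.of R (QuotSMulTop x N)) M i) := by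
  let S := ModuleCat.smulShortComplex N x
  have hS : S.ShortExact := hx.smulShortComplex_shortExact
  have hf : ∀ (i : ℕ) (α : Abelian.Ext N M i),
      (Abelian.Ext.mk₀ S.f).comp α (zero_add i) = x • α := fun i α => by
    change (Abelian.Ext.mk₀ (x • 𝟙 N)).comp α (zero_add i) = x • α
    rw [Abelian.Ext.mk₀_smul, Abelian.Ext.smul_comp, Abelian.Ext.mk₀_id_comp]
  have hinj : ∀ (i : ℕ) (α : Abelian.Ext N M i), x • α = 0 → α = 0 := fun i α h => by
    by_cases hi : i = k
    · subst hi
      exact hE (by simpa using h)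
    · have := h0 i hi
      exact Subsingleton.elim _ _
  have hg : ∀ (i : ℕ) (α : Abelian.Ext S.X₃ M i), (Abelian.Ext.mk₀ S.g).comp α (zero_add i) = 0 :=
    fun i α => by
      apply hinj i
      refine (hf i _).symm.trans ?_
      rw [Abelian.Ext.mk₀_comp_mk₀_assoc, S.zero, Abelian.Ext.mk₀_zero,
        Abelian.Ext.zero_comp]
      rfl
  constructor
  · let δ : Abelian.Ext N M k →ₗ[R] Abelian.Ext S.X₃ M (k+1) :=
      Abelian.Ext.precompOfLinear hS.extClass R M (add_comm 1 k)
    have hsurj : Function.Surjective δ := fun α =>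
      Abelian.Ext.contravariant_sequence_exact₃ hS M α (hg _ α) (add_comm 1 k)
    have hker : x • (⊤ : Submodule R (Abelian.Ext N M k)) = LinearMap.ker δ := by
      ext α
      rw [Submodule.mem_smul_pointwise_iff_exists, LinearMap.mem_ker]
      constructor
      · rintro ⟨β, -, rfl⟩
        change hS.extClass.comp (x • β) (add_comm 1 k) = 0
        rw [← hf]
        exact hS.extClass_comp_assoc β
      · intro h
        obtain ⟨β, hβ⟩ := Abelian.Ext.contravariant_sequence_exact₁ hS M α (add_comm 1 k) h
        exact ⟨β, trivial, by rw [← hβ]; exact (hf k β).symm⟩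
    exact ⟨((Submodule.quotEquivOfEq _ _ hker).trans
      (LinearMap.quotKerEquivOfSurjective _ hsurj)).symm⟩
  · intro i hi
    refine ⟨fun α β => ?_⟩
    have key : ∀ α : Abelian.Ext S.X₃ M i, α = 0 := by
      intro α
      rcases i with _ | i
      · have := Abelian.Ext.precomp_mk₀_injective_of_epi M S.g (hg := hS.epi_g)
        exact this (by simpa using hg 0 α)
      · obtain ⟨β, hβ⟩ := Abelian.Ext.contravariant_sequence_exact₃ hS M α (hg _ α) (add_comm 1 i)
        have := h0 i (by lia)
        have h0' : β = 0 := Subsingleton.elim (α := Abelian.Ext N M i) _ _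
        rw [← hβ, h0', Abelian.Ext.comp_zero]
    rw [key α, key β]

noncomputable def extCongr {X X' : ModuleCat.{u} R} (e : X ≅ X') (Y : ModuleCat.{u} R) (n : ℕ) :
    Abelian.Ext X Y n ≃ₗ[R] Abelian.Ext X' Y n :=
  LinearEquiv.ofLinearMap
    (Abelian.Ext.precompOfLinear (Abelian.Ext.mk₀ e.inv) R Y (zero_add n))
    (Abelian.Ext.precompOfLinear (Abelian.Ext.mk₀ e.hom) R Y (zero_add n))
    (by ext α; simp [Abelian.Ext.mk₀_comp_mk₀_assoc])
    (by ext α; simp [Abelian.Ext.mk₀_comp_mk₀_assoc])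

theorem ext_seq (M : Type u) [AddCommGroup M] [Module R M] (rs : List R)
    (hM : RingTheory.Sequence.IsWeaklyRegular M rs)
    (hR : RingTheory.Sequence.IsWeaklyRegular R rs) :
    (Nonempty (Abelian.Ext (ModuleCat.of R (R ⧸ (Ideal.ofList rs • ⊤ : Submodule R R)))
        (ModuleCat.of R M) rs.length ≃ₗ[R] (M ⧸ (Ideal.ofList rs • ⊤ : Submodule R M)))) ∧
      ∀ i ≠ rs.length, Subsingleton (Abelian.Ext
        (ModuleCat.of R (R ⧸ (Ideal.ofList rs • ⊤ : Submodule R R))) (ModuleCat.of R M) i) := by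
  induction rs using List.reverseRecOn with
  | nil =>
    let e : (R ⧸ (Ideal.ofList ([] : List R) • ⊤ : Submodule R R)) ≃ₗ[R] R :=
      Submodule.quotEquivOfEqBot _ (by simp)
    let e' : (M ⧸ (Ideal.ofList ([] : List R) • ⊤ : Submodule R M)) ≃ₗ[R] M :=
      Submodule.quotEquivOfEqBot _ (by simp)
    constructor
    · exact ⟨(extCongr R e.toModuleIso _ _).trans <| (Abelian.Ext.linearEquiv₀ (R := R)).trans <|
        (ModuleCat.homLinearEquiv (S := R)).trans <| (LinearMap.ringLmapEquivSelf R R M).trans e'.symm⟩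
    · intro i hi
      have : Projective (ModuleCat.of R R) :=
        ModuleCat.projective_of_free (Module.Basis.singleton Unit R)
      obtain ⟨j, rfl⟩ := Nat.exists_eq_succ_of_ne_zero hi
      have := Abelian.Ext.subsingleton_of_projective (ModuleCat.of R R) (ModuleCat.of R M) j
      exact (extCongr R e.toModuleIso _ _).toEquiv.subsingleton
  | append_singleton rs x ih =>
    rw [RingTheory.Sequence.isWeaklyRegular_append_iff,
      RingTheory.Sequence.isWeaklyRegular_singleton_iff] at hM hR
    obtain ⟨⟨e⟩, h0⟩ := ih hM.1 hR.1
    have hE : IsSMulRegular (Abelian.Ext (ModuleCat.of R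
        (R ⧸ (Ideal.ofList rs • ⊤ : Submodule R R))) (ModuleCat.of R M) rs.length) x :=
      (e.isSMulRegular_congr x).mpr hM.2
    obtain ⟨⟨e2⟩, h2⟩ := ext_step R _ _ x rs.length hR.2 hE h0
    have hperm : Ideal.ofList (rs ++ [x]) = Ideal.ofList (x :: rs) := by
      simp [Ideal.ofList_append, sup_comm]
    have hlen : (rs ++ [x]).length = rs.length + 1 := by simp
    rw [hperm, hlen]
    let f := Submodule.quotOfListConsSMulTopEquivQuotSMulTopOuter R x rs
    let f' := Submodule.quotOfListConsSMulTopEquivQuotSMulTopOuter M x rs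
    constructor
    · exact ⟨(extCongr R f.toModuleIso _ _).trans <| e2.trans <|
        (QuotSMulTop.congr x e).trans f'.symm⟩
    · intro i hi
      have := h2 i hi
      exact (extCongr R f.toModuleIso _ _).toEquiv.subsingleton

lemma ext_zero_of_smul_eq_top (a : Ideal R) (M : Type u) [AddCommGroup M] [Module R M]
    [Module.Finite R M] (h : a • (⊤ : Submodule R M) = ⊤) (i : ℕ) :
    Subsingleton (Abelian.Ext (ModuleCat.of R (R ⧸ a)) (ModuleCat.of R M) i) := by
  obtain ⟨r, hr, hr'⟩ := Submodule.exists_mem_and_smul_eq_self_of_fg_of_le_smul a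
    (⊤ : Submodule R M) Module.Finite.fg_top h.ge
  refine subsingleton_of_forall_eq 0 fun α => ?_
  have h1 : r • α = α := by
    rw [Abelian.Ext.smul_eq_comp_mk₀]
    have : r • 𝟙 (ModuleCat.of R M) = 𝟙 _ := by
      ext m
      exact hr' m trivial
    rw [this, Abelian.Ext.comp_mk₀_id]
  have h2 : r • α = 0 := by
    conv_lhs => rw [← Abelian.Ext.mk₀_id_comp α]
    rw [← Abelian.Ext.smul_comp, ← Abelian.Ext.mk₀_smul]
    have : r • 𝟙 (ModuleCat.of R (R ⧸ a)) = 0 := by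
      ext m
      change r • (1 : R ⧸ a) = 0
      rw [← map_one (Ideal.Quotient.mk a), ← Ideal.Quotient.mk_eq_mk, ← Submodule.Quotient.mk_smul]
      exact (Submodule.Quotient.mk_eq_zero a).2 (by simpa using hr)
    rw [this, Abelian.Ext.mk₀_zero, Abelian.Ext.zero_comp]
  rw [← h1, h2]

/-- if `M` is `a`-relative regular, then `Ext^i(R/a, M)` is `M/aM` for
`i = cd(a,R)` and vanishes otherwise; in particular `M` is `a`-relative Gorenstein. -/
theorem stmt18 [IsNoetherianRing R] (a : Ideal R) (ha : a ≠ ⊤)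
    (M : Type u) [AddCommGroup M] [Module R M] [Module.Finite R M]
    (hreg : IsRelRegularMod R a M) :
    Nonempty ((relExt R a (rcd R a R) M) ≃ₗ[R] (M ⧸ (a • ⊤ : Submodule R M))) ∧
      ∀ i : ℕ, i ≠ rcd R a R → Subsingleton (relExt R a i M) := by
  rcases hreg with h | ⟨-, rs, hlen, hrs, hM, hR⟩
  · have hs : ∀ i, Subsingleton (relExt R a i M) := fun i => by
      have := ext_zero_of_smul_eq_top R a M h i
      exact (ext_compare R (ModuleCat.of R (R ⧸ a)) (ModuleCat.of R M) i).some.toEquiv.subsingleton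
    have : Subsingleton (M ⧸ (a • ⊤ : Submodule R M)) :=
      Submodule.Quotient.subsingleton_iff.2 h
    have := hs (rcd R a R)
    exact ⟨⟨LinearEquiv.ofSubsingleton _ _⟩, fun i _ => hs i⟩
  · obtain ⟨⟨e⟩, h0⟩ := ext_seq R M rs hM.toIsWeaklyRegular hR.toIsWeaklyRegular
    rw [← hlen]
    subst hrs
    let f : (R ⧸ Ideal.ofList rs) ≃ₗ[R] (R ⧸ (Ideal.ofList rs • ⊤ : Submodule R R)) :=
      Submodule.quotEquivOfEq _ _ (by simp)
    constructor
    · exact ⟨(ext_compare R _ _ _).some.trans <| (extCongr R f.toModuleIso _ _).trans e⟩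
    · intro i hi
      have := h0 i hi
      exact ((ext_compare R _ _ _).some.trans (extCongr R f.toModuleIso _ _)).toEquiv.subsingleton
end

section
/- Let 𝔞 be an ideal of R contained in its Jacobson radical and assume R is 𝔞-relative regular. Then every 𝔞-relative maximal Cohen-Macaulay R-module is 𝔞-relative regular. -/
open CategoryTheory Opposite
open scoped TensorProduct

universe u

variable (R : Type u) [CommRing R]

section Helpers

open scoped Pointwise

open CategoryTheory Abelian Limits

theorem helper_ext_subsingleton {R : Type u} [CommRing R] (X Y : ModuleCat.{u} R) (n : ℕ)
    (h : Subsingleton (((_root_.Ext R (ModuleCat R) n).obj (op X)).obj Y)) :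
    Subsingleton (CategoryTheory.Abelian.Ext X Y n) := by
  let P : ProjectiveResolution X := projectiveResolution X
  have hz : IsZero ((P.complex.linearYonedaObj R Y).homology n) :=
    IsZero.of_iso (ModuleCat.isZero_of_subsingleton _) (P.isoExt n Y).symm
  have hex : (P.complex.linearYonedaObj R Y).ExactAt n := by
    rwa [HomologicalComplex.exactAt_iff_isZero_homology]
  refine subsingleton_of_forall_eq 0 fun α => ?_
  obtain ⟨f, hf, rfl⟩ := P.extMk_surjective α (n + 1) rfl
  cases n with
  | zero =>
    rw [HomologicalComplex.exactAt_iff' _ 0 0 1 (by simp) (by simp),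
      ShortComplex.moduleCat_exact_iff] at hex
    obtain ⟨g, hg⟩ := hex f hf
    have : f = 0 := by
      have : (P.complex.linearYonedaObj R Y).d 0 0 = 0 :=
        HomologicalComplex.shape _ _ _ (by simp)
      have h3 : ((P.complex.linearYonedaObj R Y).d 0 0).hom g = f := hg
      rw [this] at h3
      exact h3.symm
    subst this
    simp
  | succ p =>
    rw [HomologicalComplex.exactAt_iff' _ p (p+1) (p+2) (by simp) (by simp),
      ShortComplex.moduleCat_exact_iff] at hex
    obtain ⟨g, hg⟩ := hex f hf
    rw [P.extMk_eq_zero_iff f _ _ _ p rfl]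
    exact ⟨g, hg⟩

theorem helper_ext_congr {R : Type u} [CommRing R] {X X' : ModuleCat.{u} R} (e : X ≅ X')
    (Y : ModuleCat.{u} R) (n : ℕ)
    (h : Subsingleton (CategoryTheory.Abelian.Ext X Y n)) :
    Subsingleton (CategoryTheory.Abelian.Ext X' Y n) := by
  refine subsingleton_of_forall_eq 0 fun α => ?_
  have h1 : (Ext.mk₀ e.hom).comp α (zero_add n) = 0 := Subsingleton.elim _ _
  have h2 : (Ext.mk₀ e.inv).comp ((Ext.mk₀ e.hom).comp α (zero_add n)) (zero_add n) = α := by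
    simp
  rw [← h2, h1]; simp

theorem helper_main {R : Type u} [CommRing R] [IsNoetherianRing R] (M : ModuleCat.{u} R)
    [Module.Finite R M] (rs : List R) (hrs : ∀ r ∈ rs, r ∈ (⊥ : Ideal R).jacobson)
    (N : ModuleCat.{u} R) [Module.Finite R N] (T : ModuleCat.{u} R)
    (e : Nonempty (T ≃ₗ[R] (N ⧸ (Ideal.ofList rs • (⊤ : Submodule R N)))))
    (hN : RingTheory.Sequence.IsWeaklyRegular N rs) (n : ℕ)
    (hT : ∀ i < n + rs.length, Subsingleton (CategoryTheory.Abelian.Ext T M i))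
    (hpd : ∀ j, n < j → Subsingleton (CategoryTheory.Abelian.Ext N M j)) :
    (∀ i < n, Subsingleton (CategoryTheory.Abelian.Ext N M i)) ∧
      RingTheory.Sequence.IsWeaklyRegular (CategoryTheory.Abelian.Ext N M n) rs := by
  induction rs generalizing N n with
  | nil =>
    refine ⟨fun i hi => ?_, RingTheory.Sequence.IsWeaklyRegular.nil _ _⟩
    obtain ⟨e⟩ := e
    have e' : T ≃ₗ[R] N := e.trans (Submodule.quotEquivOfEqBot _ (by simp))
    exact helper_ext_congr e'.toModuleIso M i (hT i (by simpa using hi))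
  | cons x rs ih =>
    rw [RingTheory.Sequence.isWeaklyRegular_cons_iff] at hN
    obtain ⟨hx, hN'⟩ := hN
    have hS := hx.smulShortComplex_shortExact
    have hxj : x ∈ (⊥ : Ideal R).jacobson := hrs x (by simp)
    let N' : ModuleCat.{u} R := ModuleCat.of R (QuotSMulTop x N)
    have : Module.Finite R N' := inferInstanceAs (Module.Finite R (QuotSMulTop x N))
    have hmul : ∀ (i : ℕ) (α : CategoryTheory.Abelian.Ext N M i),
        (Ext.mk₀ (N.smulShortComplex x).f).comp α (zero_add i) = x • α := by
      intro i α
      have h3 : (Ext.mk₀ (x • 𝟙 N)).comp α (zero_add i) = x • α := by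
        rw [Ext.mk₀_smul, Ext.smul_comp, Ext.mk₀_id_comp]
      exact h3
    obtain ⟨h1, h2⟩ := ih (fun r hr => hrs r (by simp [hr])) N'
      (e.map fun e => e.trans (Submodule.quotOfListConsSMulTopEquivQuotSMulTopInner N x rs)) hN'
      (n + 1) (fun i hi => hT i (by simp; omega)) (fun j hj => by
        obtain ⟨k, rfl⟩ : ∃ k, j = 1 + k := ⟨j - 1, by omega⟩
        refine subsingleton_of_forall_eq 0 fun α => ?_
        have := hpd k (by omega)
        have := hpd (1 + k) (by omega)
        obtain ⟨β, rfl⟩ := Ext.contravariant_sequence_exact₃ hS M α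
          (@Subsingleton.elim _ this _ _) (n₀ := k) rfl
        have hb : β = 0 := @Subsingleton.elim _ (hpd k (by omega)) _ _
        rw [hb]; simp; rfl)
    constructor
    · intro i hi
      have h0 := h1 (1 + i) (by omega)
      have hsurj : ∀ α : CategoryTheory.Abelian.Ext N M i, ∃ β, x • β = α := by
        intro α
        obtain ⟨β, hβ⟩ := Ext.contravariant_sequence_exact₁ hS M α (n₁ := 1 + i) rfl
          (@Subsingleton.elim _ h0 _ _)
        exact ⟨β, (hmul i β).symm.trans hβ⟩
      have hbot : (⊤ : Submodule R (CategoryTheory.Abelian.Ext N M i)) = ⊥ := by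
        refine Submodule.eq_bot_of_le_smul_of_le_jacobson_bot (Ideal.span {x}) _
          (Module.Finite.fg_top) ?_ ?_
        · intro α _
          obtain ⟨β, rfl⟩ := hsurj α
          exact Submodule.smul_mem_smul (Ideal.mem_span_singleton_self x) trivial
        · rwa [Ideal.span_singleton_le_iff_mem]
      exact (Submodule.subsingleton_iff R).mp (subsingleton_of_bot_eq_top hbot.symm)
    · refine RingTheory.Sequence.IsWeaklyRegular.cons ?_ ?_
      · rw [isSMulRegular_iff_right_eq_zero_of_smul]
        intro α hα
        obtain ⟨β, hβ⟩ := Ext.contravariant_sequence_exact₂ hS M α ((hmul n α).trans hα)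
        have hb : β = 0 := @Subsingleton.elim _ (h1 n (by omega)) _ _
        rw [← hβ, hb]; simp; rfl
      · let φ : CategoryTheory.Abelian.Ext N M n →ₗ[R] CategoryTheory.Abelian.Ext N' M (n + 1) :=
          hS.extClass.precompOfLinear R M (add_comm 1 n)
        have hφs : Function.Surjective φ := by
          intro α
          exact Ext.contravariant_sequence_exact₃ hS M α
            (@Subsingleton.elim _ (hpd (n + 1) (by omega)) _ _) (add_comm 1 n)
        have hker : LinearMap.ker φ = x • (⊤ : Submodule R (CategoryTheory.Abelian.Ext N M n)) := by
          ext α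
          rw [LinearMap.mem_ker, Submodule.mem_smul_pointwise_iff_exists]
          constructor
          · intro h
            obtain ⟨β, hβ⟩ := Ext.contravariant_sequence_exact₁ hS M α (add_comm 1 n) h
            exact ⟨β, trivial, (hmul n β).symm.trans hβ⟩
          · rintro ⟨β, -, rfl⟩
            rw [← hmul]
            exact hS.extClass_comp_assoc β (h := add_comm 1 n)
        let E : QuotSMulTop x (CategoryTheory.Abelian.Ext N M n) ≃ₗ[R]
            CategoryTheory.Abelian.Ext N' M (n + 1) :=
          (Submodule.quotEquivOfEq _ _ hker.symm).trans (φ.quotKerEquivOfSurjective hφs)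
        exact (E.isWeaklyRegular_congr rs).mpr h2

end Helpers

/-- if `a` is in the Jacobson radical and `R` is `a`-relative regular,
then every `a`-relative maximal Cohen-Macaulay module is `a`-relative regular. -/
theorem stmt19 [IsNoetherianRing R] (a : Ideal R)
    (hJac : a ≤ (⊥ : Ideal R).jacobson)
    (hreg : IsRelRegularRing R a) :
    ∀ (M : Type u) [AddCommGroup M] [Module R M] [Module.Finite R M],
      rgrade R a M = rcd R a R → IsRelRegularMod R a M := by
  intro M _ _ _ hM
  by_cases haM : a • (⊤ : Submodule R M) = ⊤
  · exact Or.inl haM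
  refine Or.inr ⟨haM, ?_⟩
  obtain ⟨rs, hrs, hlen, hspan⟩ := hreg
  refine ⟨rs, hlen, hspan, ⟨?_, ?_⟩, hrs⟩
  · have hproj : Projective (ModuleCat.of R R) :=
      (IsProjective.iff_projective R).mp inferInstance
    have key := helper_main (ModuleCat.of R M) rs
      (fun r hr => hJac (hspan ▸ Ideal.subset_span hr)) (ModuleCat.of R R)
      (ModuleCat.of R (R ⧸ a))
      ⟨Submodule.quotEquivOfEq _ _ (by rw [hspan]; simp)⟩ hrs.toIsWeaklyRegular 0
      (fun i hi => by
        apply helper_ext_subsingleton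
        rw [← not_nontrivial_iff_subsingleton]
        intro hn
        have : rgrade R a M ≤ i := Nat.sInf_le hn
        omega)
      (fun j hj => by
        obtain ⟨k, rfl⟩ : ∃ k, j = k + 1 := ⟨j - 1, by omega⟩
        exact subsingleton_of_forall_eq 0 fun α =>
          CategoryTheory.Abelian.Ext.eq_zero_of_projective α)
    let E : CategoryTheory.Abelian.Ext (ModuleCat.of R R) (ModuleCat.of R M) 0 ≃ₗ[R] M :=
      (CategoryTheory.Abelian.Ext.linearEquiv₀.trans ModuleCat.homLinearEquiv).trans
        (LinearMap.ringLmapEquivSelf R R M)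
    exact (E.isWeaklyRegular_congr rs).mp key.2
  · rw [hspan]; exact fun h => haM h.symm
end
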